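/- arXiv:2512.23651 — 6 statements merged into one kernel-verified Lean document; each statement's English description precedes it below -/
import Mathlib

section
/- Let d ≥ 2, let 0 < ε < 1/(16(d+1)), let P be a d-polytope in ℝ^d, and let 𝒫 = {xᵢ + τᵢP : xᵢ ∈ ℝ^d, τᵢ > 0, i = 1, …, n} be a weakly non-separable family of positive homothets of P. Assume that whenever ⋃𝒫 ⊆ x + μP for some x ∈ ℝ^d and μ > 0, one has μ ≥ ((d+1)/2 − ε)·Σᵢ₌₁ⁿ τᵢ (i.e., the smallest positive homothetic copy of P covering ⋃𝒫 has homothety ratio at least ((d+1)/2 − ε)·Σᵢτᵢ). Then for every d-simplex S in ℝ^d, the Banach–Mazur distance satisfies d_BM(P, S) ≤ 1 + 16(d+1)ε. -/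
open Set Metric Pointwise MeasureTheory

noncomputable section

abbrev Euc (d : ℕ) := EuclideanSpace ℝ (Fin d)

variable {d : ℕ}

/-- A convex body: compact, convex, with nonempty interior. -/
def IsConvexBody (K : Set (Euc d)) : Prop :=
  IsCompact K ∧ Convex ℝ K ∧ (interior K).Nonempty

/-- A hyperplane of `ℝ^d`. -/
def IsHyperplane (H : Set (Euc d)) : Prop :=
  ∃ u : Euc d, u ≠ 0 ∧ ∃ c : ℝ, H = {x : Euc d | (inner ℝ x u : ℝ) = c}

/-- A straight line in `ℝ^d`. -/
def IsLine (L : Set (Euc d)) : Prop :=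
  ∃ p v : Euc d, v ≠ 0 ∧ L = {x : Euc d | ∃ t : ℝ, x = p + t • v}

/-- A `d`-polytope: convex hull of finitely many points, with nonempty interior. -/
def IsPolytope (P : Set (Euc d)) : Prop :=
  ∃ S : Finset (Euc d), P = convexHull ℝ (S : Set (Euc d)) ∧ (interior P).Nonempty

/-- A `d`-simplex: convex hull of `d+1` affinely independent points. -/
def IsSimplex (d : ℕ) (T : Set (Euc d)) : Prop :=
  ∃ v : Fin (d + 1) → Euc d, AffineIndependent ℝ v ∧ T = convexHull ℝ (Set.range v)

/-- The exposed face of `P` in direction `u`. -/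
def exposedFaceAt (P : Set (Euc d)) (u : Euc d) : Set (Euc d) :=
  {x ∈ P | ∀ y ∈ P, (inner ℝ y u : ℝ) ≤ (inner ℝ x u : ℝ)}

/-- `u` is the outer unit normal vector of a facet of `P`. -/
def IsFacetNormal (P : Set (Euc d)) (u : Euc d) : Prop :=
  ‖u‖ = 1 ∧ Module.finrank ℝ (affineSpan ℝ (exposedFaceAt P u)).direction = d - 1

/-- The hyperplane `H` is parallel to some facet of `P`:
some translate of `H` contains the facet. -/
def HypParallelToFacet (P H : Set (Euc d)) : Prop :=
  ∃ u : Euc d, IsFacetNormal P u ∧ ∃ v : Euc d, exposedFaceAt P u ⊆ (fun x => v + x) '' H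

/-- The positive homothet `x + τ • P`. -/
def homo (x : Euc d) (τ : ℝ) (P : Set (Euc d)) : Set (Euc d) := {x} + τ • P

/-- A weakly non-separable family of positive homothets of the polytope `P`. -/
def WNS (P : Set (Euc d)) {n : ℕ} (x : Fin n → Euc d) (τ : Fin n → ℝ) : Prop :=
  ∀ H : Set (Euc d), IsHyperplane H → HypParallelToFacet P H →
    (H ∩ convexHull ℝ (⋃ i, homo (x i) (τ i) P)).Nonempty →
    ∃ i, (H ∩ homo (x i) (τ i) P).Nonempty

/-- A non-separable family of convex bodies. -/
def NS {n : ℕ} (F : Fin n → Set (Euc d)) : Prop :=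
  ∀ H : Set (Euc d), IsHyperplane H →
    (H ∩ convexHull ℝ (⋃ i, F i)).Nonempty → ∃ i, (H ∩ F i).Nonempty

/-- `A` is a `k`-dimensional affine subspace of `ℝ^d` (as a set). -/
def IsAffSub (k : ℕ) (A : Set (Euc d)) : Prop :=
  ∃ S : AffineSubspace ℝ (Euc d), (S : Set (Euc d)) = A ∧ A.Nonempty ∧
    Module.finrank ℝ S.direction = k

/-- The affine subspace `A` is parallel to some facet of `P`:
some translate of `A` is contained in the affine hull of the facet. -/
def SubParallelToFacet (P A : Set (Euc d)) : Prop :=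
  ∃ u : Euc d, IsFacetNormal P u ∧ ∃ v : Euc d,
    (fun x => v + x) '' A ⊆ (affineSpan ℝ (exposedFaceAt P u) : Set (Euc d))

/-- A weakly `k`-impassable family of positive homothets of the polytope `P`. -/
def WIP (k : ℕ) (P : Set (Euc d)) {n : ℕ} (x : Fin n → Euc d) (τ : Fin n → ℝ) : Prop :=
  ∀ A : Set (Euc d), IsAffSub k A → SubParallelToFacet P A →
    (A ∩ convexHull ℝ (⋃ i, homo (x i) (τ i) P)).Nonempty →
    ∃ i, (A ∩ homo (x i) (τ i) P).Nonempty

/-- A full-rank lattice in `ℝ^d`. -/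
def IsFullLattice (L : Set (Euc d)) : Prop :=
  ∃ b : Module.Basis (Fin d) ℝ (Euc d),
    L = Set.range fun z : Fin d → ℤ => ∑ i, (z i : ℝ) • b i

/-- The integer lattice `ℤ^d` as a subset of `ℝ^d`. -/
def intLattice (d : ℕ) : Set (Euc d) := {x : Euc d | ∀ i, ∃ z : ℤ, x i = (z : ℝ)}

/-- The unit cube `[0,1]^d`. -/
def unitCube (d : ℕ) : Set (Euc d) := {x : Euc d | ∀ i, x i ∈ Set.Icc (0 : ℝ) 1}

/-- The axis-parallel hyperplane `{x : x_j = c}`. -/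
def axisHyp (d : ℕ) (j : Fin d) (c : ℝ) : Set (Euc d) := {x : Euc d | x j = c}

/-- A weakly non-separable family of translates of the unit cube. -/
def CubeWNS {d n : ℕ} (p : Fin n → Euc d) : Prop :=
  ∀ (j : Fin d) (c : ℝ),
    (axisHyp d j c ∩ convexHull ℝ (⋃ k, {p k} + unitCube d)).Nonempty →
    ∃ k, (axisHyp d j c ∩ ({p k} + unitCube d)).Nonempty


/-- The Banach–Mazur distance of two convex bodies. -/
def bmDist (K L : Set (Euc d)) : ℝ :=
  sInf {lam : ℝ | 0 < lam ∧ ∃ (T : Euc d ≃ₗ[ℝ] Euc d) (u v : Euc d),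
    ({u} + K) ⊆ (T : Euc d → Euc d) '' ({v} + L) ∧
    (T : Euc d → Euc d) '' ({v} + L) ⊆ lam • ({u} + K)}

/-- A vector whose image under the transpose of a nearly diagonal stochastic matrix is bounded
below is nonnegative. -/
theorem nonneg_of_stochastic_of_diag {ι : Type*} [Fintype ι] {Λ : ι → ι → ℝ} {δ : ℝ}
    (hδ0 : 0 ≤ δ) (hδ : δ < 1 / 2) (hΛ0 : ∀ j i, 0 ≤ Λ j i) (hΛ1 : ∀ j, ∑ i, Λ j i = 1)
    (hdiag : ∀ j, 1 - δ ≤ Λ j j) {c : ι → ℝ} (hc : 0 ≤ ∑ j, c j)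
    (h : ∀ i, δ * ∑ j, c j ≤ ∑ j, c j * Λ j i) (i : ι) : 0 ≤ c i := by
  classical
  by_contra! hi
  set N : Finset ι := Finset.univ.filter fun j => c j < 0 with hN
  have hiN : i ∈ N := by simp [hN, hi]
  have hneg : ∑ j ∈ N, c j < 0 :=
    Finset.sum_neg (fun j hj => by simpa [hN] using hj) ⟨i, hiN⟩
  have lower : δ * ∑ j, c j ≤ ∑ k ∈ N, ∑ j, c j * Λ j k := by
    refine (h i).trans ?_
    exact Finset.single_le_sum (f := fun k => ∑ j, c j * Λ j k)
      (fun k _ => (mul_nonneg hδ0 hc).trans (h k)) hiN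
  have upper : ∑ k ∈ N, ∑ j, c j * Λ j k ≤
      ∑ j, (δ * c j + (1 - 2 * δ) * if c j < 0 then c j else 0) := by
    rw [Finset.sum_comm]
    refine Finset.sum_le_sum fun j _ => ?_
    rw [← Finset.mul_sum]
    by_cases hj : c j < 0
    · have : Λ j j ≤ ∑ k ∈ N, Λ j k :=
        Finset.single_le_sum (f := fun k => Λ j k) (fun k _ => hΛ0 j k) (by simp [hN, hj])
      rw [if_pos hj]
      nlinarith [hdiag j]
    · have : ∑ k ∈ N, Λ j k + Λ j j ≤ 1 := by
        rw [← hΛ1 j, add_comm, ← Finset.sum_insert (by simp [hN, not_lt.1 hj])]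
        exact Finset.sum_le_sum_of_subset_of_nonneg (Finset.subset_univ _) fun k _ _ => hΛ0 j k
      rw [if_neg hj]
      nlinarith [hdiag j, not_lt.1 hj]
  rw [Finset.sum_add_distrib, ← Finset.mul_sum, ← Finset.mul_sum, ← Finset.sum_filter,
    ← hN] at upper
  nlinarith

/-- If finitely many closed intervals `[b j - τ j * w, b j]` cover every `(b i, B]`, then the
weighted mean of the right endpoints is not far to the left of `B`. -/
theorem sum_mul_sub_le_of_cover {ι : Type*} [Fintype ι] {τ b : ι → ℝ} {w B : ℝ}
    (hτ : ∀ i, 0 ≤ τ i) (hw : 0 ≤ w)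
    (hcov : ∀ i, ∀ t ∈ Ioc (b i) B, ∃ j, b j - τ j * w ≤ t ∧ t ≤ b j) :
    ∑ i, τ i * (B - b i) ≤ w * ((∑ i, τ i) ^ 2 - ∑ i, τ i ^ 2) / 2 := by
  classical
  have hlen : ∀ i, B - b i ≤ ∑ j, if b i < b j then τ j * w else 0 := by
    intro i
    have hsub : Ioc (b i) B ⊆ ⋃ j ∈ Finset.univ.filter fun j => b i < b j,
        Icc (b j - τ j * w) (b j) := by
      intro t ht
      obtain ⟨j, hj⟩ := hcov i t ht
      simp only [Finset.mem_filter, Finset.mem_univ, true_and, mem_iUnion]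
      exact ⟨j, ht.1.trans_le hj.2, hj⟩
    have hvol := (measure_mono (μ := volume) hsub).trans (measure_biUnion_finset_le _ _)
    simp only [Real.volume_Ioc, Real.volume_Icc, sub_sub_cancel] at hvol
    rw [← ENNReal.ofReal_sum_of_nonneg fun j _ => mul_nonneg (hτ j) hw] at hvol
    rw [← Finset.sum_filter]
    exact (ENNReal.ofReal_le_ofReal_iff
      (Finset.sum_nonneg fun j _ => mul_nonneg (hτ j) hw)).1 hvol
  set A := ∑ i, ∑ j, if b i < b j then τ i * τ j else 0 with hA
  have hle : ∑ i, τ i * (B - b i) ≤ w * A := by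
    rw [hA, Finset.mul_sum]
    refine Finset.sum_le_sum fun i _ => (mul_le_mul_of_nonneg_left (hlen i) (hτ i)).trans_eq ?_
    rw [Finset.mul_sum, Finset.mul_sum]
    refine Finset.sum_congr rfl fun j _ => ?_
    split_ifs <;> ring
  have hswap : A = ∑ i, ∑ j, if b j < b i then τ i * τ j else 0 := by
    rw [hA, Finset.sum_comm]
    simp only [mul_comm]
  have hsq : ∑ i, τ i ^ 2 = ∑ i, ∑ j, if i = j then τ i * τ j else 0 := by
    simp [pow_two]
  have htot : A + A + ∑ i, τ i ^ 2 ≤ (∑ i, τ i) ^ 2 := by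
    nth_rewrite 2 [hswap]
    rw [hsq, hA, pow_two, Finset.sum_mul_sum, ← Finset.sum_add_distrib, ← Finset.sum_add_distrib]
    refine Finset.sum_le_sum fun i _ => ?_
    rw [← Finset.sum_add_distrib, ← Finset.sum_add_distrib]
    refine Finset.sum_le_sum fun j _ => ?_
    have := mul_nonneg (hτ i) (hτ j)
    rcases lt_trichotomy (b i) (b j) with hij | hij | hij
    · have hne : i ≠ j := by rintro rfl; exact lt_irrefl _ hij
      simp [hij, hij.not_gt, hne]
    · simp only [hij, lt_irrefl, if_false, zero_add]
      split_ifs <;> linarith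
    · have hne : i ≠ j := by rintro rfl; exact lt_irrefl _ hij
      simp [hij, hij.not_gt, hne]
  nlinarith

/-- If no translate of `-P` lies in `s • P`, then `P` carries nonnegative affine functions
`x ↦ b i - g i x` forming a partition of unity, each being almost maximal somewhere on `P`. -/
theorem exists_partition_of_no_translate {P : Set (Euc d)} (hcomp : IsCompact P)
    (hconv : Convex ℝ P) (hne : P.Nonempty) {s : ℝ}
    (hs : ∀ c : Euc d, ∃ p ∈ P, c - p ∉ s • P) :
    ∃ (p : Fin (d + 1) → Euc d) (b : Fin (d + 1) → ℝ) (g : Fin (d + 1) → Euc d →L[ℝ] ℝ),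
      (∀ i, p i ∈ P) ∧ (∀ i, ∀ x ∈ P, 0 ≤ b i - g i x) ∧ (∑ i, b i = 1) ∧
      (∀ x, ∑ i, g i x = 0) ∧ ∀ i, 1 - (d - s) ≤ b i - g i (p i) := by
  classical
  have helly : ∃ p : Fin (d + 1) → Euc d, (∀ i, p i ∈ P) ∧ ∀ c, ∃ i, c - p i ∉ s • P := by
    by_contra! hcon
    have hF : (⋂ p : P, (fun y => (p : Euc d) + y) '' (s • P)).Nonempty := by
      refine Convex.helly_theorem_compact' (𝕜 := ℝ)
        (fun p => by simpa using (hconv.smul s).translate (p : Euc d))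
        (fun p => (hcomp.smul s).image (by fun_prop)) fun I hI => ?_
      rcases I.eq_empty_or_nonempty with rfl | hIne
      · simp
      have : Nonempty I := hIne.to_subtype
      obtain ⟨e⟩ := Function.Embedding.nonempty_of_card_le (α := I) (β := Fin (d + 1))
        (by simpa using hI)
      obtain ⟨c, hc⟩ := hcon (fun i => ((Function.invFun e i : I) : P)) fun i => Subtype.prop _
      refine ⟨c, mem_iInter₂.2 fun q hq => ⟨c - q, ?_, by simp⟩⟩
      simpa [Function.leftInverse_invFun e.injective ⟨q, hq⟩] using hc (e ⟨q, hq⟩)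
    obtain ⟨c, hc⟩ := hF
    obtain ⟨p, hp, hcp⟩ := hs c
    obtain ⟨y, hy, rfl⟩ := mem_iInter.1 hc ⟨p, hp⟩
    simp [hy] at hcp
  obtain ⟨p, hp, hpc⟩ := helly
  set A : Set (Fin (d + 1) → Euc d) :=
    Set.pi univ fun i => (fun y => p i + y) '' (s • P) with hA
  set D : Submodule ℝ (Fin (d + 1) → Euc d) :=
    LinearMap.range (LinearMap.pi fun _ => LinearMap.id) with hD
  have hdisj : Disjoint A (D : Set (Fin (d + 1) → Euc d)) := by
    rw [Set.disjoint_left]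
    rintro _ ha ⟨c, rfl⟩
    obtain ⟨i, hi⟩ := hpc c
    obtain ⟨y, hy, hyc⟩ := ha i (mem_univ i)
    apply hi
    have : c = p i + y := by simpa using hyc.symm
    simpa [this] using hy
  obtain ⟨f, r, r', hfA, hr, hfD⟩ := geometric_hahn_banach_compact_closed
    (convex_pi fun i _ => by simpa using (hconv.smul s).translate (p i))
    (isCompact_univ_pi fun i => (hcomp.smul s).image (by fun_prop))
    D.convex D.closed_of_finiteDimensional hdisj
  have hfD0 : ∀ y ∈ D, f y = 0 := by
    intro y hy
    by_contra hne
    have := hfD ((r' / f y) • y) (D.smul_mem _ hy)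
    rw [map_smul, smul_eq_mul, div_mul_cancel₀ _ hne] at this
    exact lt_irrefl _ this
  have hr0 : r' < 0 := by simpa using hfD 0 D.zero_mem
  set g : Fin (d + 1) → Euc d →L[ℝ] ℝ :=
    fun i => f.comp (ContinuousLinearMap.single ℝ (fun _ => Euc d) i) with hg
  have hfg : ∀ y, f y = ∑ i, g i (y i) := by
    intro y
    conv_lhs => rw [← Finset.univ_sum_single y]
    simp [hg]
  have hg0 : ∀ x, ∑ i, g i x = 0 := fun x => by
    rw [← hfg fun _ => x]
    exact hfD0 _ ⟨x, rfl⟩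
  choose q hq hqmax using fun i => hcomp.exists_isMaxOn hne (g i).continuous.continuousOn
  have hqle : ∀ i, ∀ x ∈ P, 0 ≤ g i (q i) - g i x := fun i x hx => sub_nonneg.2 (hqmax i hx)
  set H := ∑ i, g i (q i) with hH
  have hsum : ∀ x, ∑ i, (g i (q i) - g i x) = H := fun x => by
    rw [Finset.sum_sub_distrib, hg0, sub_zero]
  have hleH : ∀ i, ∀ x ∈ P, g i (q i) - g i x ≤ H := fun i x hx => by
    rw [← hsum x]
    exact Finset.single_le_sum (f := fun i => g i (q i) - g i x) (fun j _ => hqle j x hx)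
      (Finset.mem_univ i)
  have hlt : (1 + s) * H < ∑ i, (g i (q i) - g i (p i)) := by
    have h1 := hfA (fun i => p i + s • q i)
      fun i _ => ⟨s • q i, Set.smul_mem_smul_set (hq i), rfl⟩
    rw [hfg] at h1
    simp only [map_add, map_smul, smul_eq_mul, Finset.sum_add_distrib, ← Finset.mul_sum] at h1
    rw [Finset.sum_sub_distrib]
    linarith
  have hbig : ∀ i, (1 - (d - s)) * H ≤ g i (q i) - g i (p i) := by
    intro i
    have h1 : ∑ j ∈ Finset.univ.erase i, (g j (q j) - g j (p j)) ≤ d * H := by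
      refine (Finset.sum_le_card_nsmul _ _ H fun j _ => hleH j _ (hp j)).trans_eq ?_
      simp
    rw [← Finset.add_sum_erase _ _ (Finset.mem_univ i)] at hlt
    linarith
  have hH0 : 0 < H := by
    refine lt_of_le_of_ne ((hqle 0 _ (hp 0)).trans (hleH 0 _ (hp 0))) fun h0 => ?_
    rw [← h0, mul_zero] at hlt
    have : ∑ i, (g i (q i) - g i (p i)) ≤ 0 :=
      Finset.sum_nonpos fun i _ => (hleH i _ (hp i)).trans_eq h0.symm
    linarith
  refine ⟨p, fun i => H⁻¹ * g i (q i), fun i => H⁻¹ • g i, hp, fun i x hx => ?_, ?_, fun x => ?_,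
    fun i => ?_⟩
  · have := mul_nonneg (inv_nonneg.2 hH0.le) (hqle i x hx)
    simpa [mul_sub] using this
  · rw [← Finset.mul_sum, ← hH, inv_mul_cancel₀ hH0.ne']
  · simp [← Finset.mul_sum, hg0]
  · have := mul_le_mul_of_nonneg_left (hbig i) (inv_nonneg.2 hH0.le)
    rw [mul_comm _ H, inv_mul_cancel_left₀ hH0.ne'] at this
    simpa [mul_sub] using this

/-- If `P` is contained in the dilate with ratio `(1 - t)⁻¹` of an inscribed simplex, then its
Banach–Mazur distance from any simplex is at most `(1 - t)⁻¹`. -/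
theorem bmDist_le_of_inscribed_simplex {P S : Set (Euc d)} (hconv : Convex ℝ P)
    (hS : IsSimplex d S) {p : Fin (d + 1) → Euc d} (hp : AffineIndependent ℝ p)
    (hpP : ∀ i, p i ∈ P) {t : ℝ} (ht : t < 1) (o : Euc d)
    (hPp : ∀ x ∈ P, o + (1 - t) • (x - o) ∈ convexHull ℝ (range p)) :
    bmDist P S ≤ (1 - t)⁻¹ := by
  obtain ⟨v, hv, rfl⟩ := hS
  have h1t : 0 < 1 - t := sub_pos.2 ht
  have hcard : Fintype.card (Fin (d + 1)) = Module.finrank ℝ (Euc d) + 1 := by simp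
  let bv : AffineBasis (Fin (d + 1)) ℝ (Euc d) :=
    ⟨v, hv, hv.affineSpan_eq_top_iff_card_eq_finrank_add_one.2 hcard⟩
  let bp : AffineBasis (Fin (d + 1)) ℝ (Euc d) :=
    ⟨p, hp, hp.affineSpan_eq_top_iff_card_eq_finrank_add_one.2 hcard⟩
  let T₀ : Euc d ≃ₗ[ℝ] Euc d := (bv.basisOf 0).equiv (bp.basisOf 0) (Equiv.refl _)
  have hT₀ : ∀ j, T₀ (v j - v 0) = p j - p 0 := by
    intro j
    rcases eq_or_ne j 0 with rfl | hj
    · simp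
    have h1 : v j - v 0 = bv.basisOf 0 ⟨j, hj⟩ := by rw [bv.basisOf_apply]; rfl
    rw [h1, Module.Basis.equiv_apply, bp.basisOf_apply]
    rfl
  let T : Euc d ≃ₗ[ℝ] Euc d := T₀.trans (LinearEquiv.smulOfNeZero ℝ (Euc d) (1 - t)⁻¹
    (inv_ne_zero h1t.ne'))
  have hT : ∀ z, T z = (1 - t)⁻¹ • T₀ z := fun z => rfl
  let a : Euc d := T₀.symm (p 0 - o) - v 0
  have himage : (T : Euc d → Euc d) '' ({a} + convexHull ℝ (range v)) =
      {z | o + (1 - t) • z ∈ convexHull ℝ (range p)} := by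
    let A : Euc d →ᵃ[ℝ] Euc d :=
      T₀.toLinearMap.toAffineMap + AffineMap.const ℝ (Euc d) (T₀ a + o)
    have hA : ∀ z, A z = T₀ (a + z) + o := fun z => by
      simp only [A, map_add, Pi.add_apply, AffineMap.coe_add, LinearMap.coe_toAffineMap,
        LinearEquiv.coe_coe, AffineMap.coe_const, Function.const_apply]
      abel
    have hAv : ∀ j, A (v j) = p j := fun j => by
      have : a + v j = T₀.symm (p 0 - o) + (v j - v 0) := by simp only [a]; abel
      rw [hA, this, map_add, hT₀, LinearEquiv.apply_symm_apply]
      abel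
    have hhull : A '' convexHull ℝ (range v) = convexHull ℝ (range p) := by
      rw [AffineMap.image_convexHull, ← range_comp]
      congr 2
      exact funext hAv
    rw [← hhull]
    ext z
    simp only [singleton_add, image_image, mem_image, mem_ofPred_eq, hA, hT]
    refine exists_congr fun y => and_congr_right fun _ => ?_
    constructor
    · rintro rfl
      rw [smul_inv_smul₀ h1t.ne', add_comm]
    · intro h
      rw [add_comm o] at h
      rw [add_right_cancel h, inv_smul_smul₀ h1t.ne']
  refine csInf_le ⟨0, fun _ h => h.1.le⟩ ⟨inv_pos.2 h1t, T, -o, a, ?_, ?_⟩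
  · rw [himage]
    rintro _ ⟨_, rfl, x, hx, rfl⟩
    simpa [neg_add_eq_sub] using hPp x hx
  · rw [himage]
    intro z hz
    rw [mem_inv_smul_set_iff₀ h1t.ne']
    refine ⟨-o, rfl, _, convexHull_min (range_subset_iff.2 hpP) hconv hz, ?_⟩
    simp

/-- Stability of the Minkowski measure of asymmetry near its maximum. -/
theorem bmDist_le_of_no_translate {P S : Set (Euc d)} (hcomp : IsCompact P) (hconv : Convex ℝ P)
    (hne : P.Nonempty) (hS : IsSimplex d S) {δ : ℝ} (hδ0 : 0 ≤ δ) (hδ : 4 * (d + 1) * δ < 1)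
    (hδ2 : δ < 1 / 2)
    (hs : ∀ c : Euc d, ∃ p ∈ P, c - p ∉ ((d : ℝ) - δ) • P) :
    bmDist P S ≤ 1 + 4 * (d + 1) * δ := by
  obtain ⟨p, b, g, hp, hnn, hb, hg, hdiag⟩ := exists_partition_of_no_translate hcomp hconv hne hs
  rw [sub_sub_cancel] at hdiag
  have key : ∀ c : Fin (d + 1) → ℝ, 0 ≤ ∑ j, c j →
      (∀ i, δ * ∑ j, c j ≤ (∑ j, c j) * b i - g i (∑ j, c j • p j)) → ∀ i, 0 ≤ c i := by
    intro c hc h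
    refine nonneg_of_stochastic_of_diag (Λ := fun j i => b i - g i (p j)) hδ0 hδ2
      (fun j i => hnn i _ (hp j)) (fun j => by rw [Finset.sum_sub_distrib, hb, hg, sub_zero])
      hdiag hc fun i => (h i).trans_eq ?_
    simp [mul_sub, Finset.sum_sub_distrib, Finset.sum_mul]
  have hind : AffineIndependent ℝ p := by
    rw [affineIndependent_iff_of_fintype]
    intro c hc hcp i
    rw [Finset.weightedVSub_eq_linear_combination _ hc] at hcp
    have h0 : ∀ i, 0 ≤ c i := key c hc.ge fun i => by simp [hc, hcp]
    exact (Finset.sum_eq_zero_iff_of_nonneg fun i _ => h0 i).1 hc i (Finset.mem_univ i)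
  let bp : AffineBasis (Fin (d + 1)) ℝ (Euc d) :=
    ⟨p, hind, hind.affineSpan_eq_top_iff_card_eq_finrank_add_one.2 (by simp)⟩
  have hmem : ∀ y, (∀ i, δ ≤ b i - g i y) → y ∈ convexHull ℝ (range p) := by
    intro y hy
    have hsum : ∑ i, bp.coord i y = 1 := bp.sum_coord_apply_eq_one y
    have hcomb : ∑ i, bp.coord i y • p i = y := bp.linear_combination_coord_eq_self y
    rw [← hcomb]
    refine (convex_convexHull ℝ (range p)).sum_mem (fun i _ => ?_) hsum
      fun i _ => subset_convexHull ℝ _ (mem_range_self i)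
    refine key (fun i => bp.coord i y) (by rw [hsum]; exact zero_le_one) (fun i => ?_) i
    rw [hsum, hcomb, mul_one, one_mul]
    exact hy i
  have hd1 : (0 : ℝ) < d + 1 := by positivity
  set o : Euc d := ((d : ℝ) + 1)⁻¹ • ∑ j, p j with ho
  have hob : ∀ i, (1 - δ) / (d + 1) ≤ b i - g i o := by
    intro i
    have h1 : b i - g i o = (∑ j, (b i - g i (p j))) / (d + 1) := by
      rw [ho, Finset.sum_sub_distrib, map_smul, map_sum, smul_eq_mul]
      simp only [Finset.sum_const, Finset.card_univ, Fintype.card_fin, nsmul_eq_mul]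
      push_cast
      field_simp
    rw [h1]
    gcongr
    exact (hdiag i).trans (Finset.single_le_sum (f := fun j => b i - g i (p j))
      (fun j _ => hnn i _ (hp j)) (Finset.mem_univ i))
  set t : ℝ := 2 * (d + 1) * δ with htdef
  have ht0 : 0 ≤ t := by positivity
  have ht : t < 1 / 2 := by linarith
  refine (bmDist_le_of_inscribed_simplex hconv hS hind hp (t := t) (by linarith) o
    fun x hx => hmem _ fun i => ?_).trans ?_
  · have h1 : t * ((1 - δ) / (d + 1)) ≤ t * (b i - g i o) := mul_le_mul_of_nonneg_left (hob i) ht0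
    have h2 : t * ((1 - δ) / (d + 1)) = 2 * δ * (1 - δ) := by
      rw [htdef]; field_simp
    have h3 := mul_nonneg (by linarith : 0 ≤ 1 - t) (hnn i x hx)
    simp only [map_add, map_smul, map_sub, smul_eq_mul]
    nlinarith
  · rw [inv_le_iff_one_le_mul₀ (by linarith)]
    nlinarith

/-- The vertices at which a vertex of the polar body is active span the space. -/
theorem span_active_eq_top {V : Finset (Euc d)} {z w : Euc d}
    (hw : w ∈ extremePoints ℝ {w : Euc d | ∀ p ∈ V, (inner ℝ (p - z) w : ℝ) ≤ 1}) :
    Submodule.span ℝ {a : Euc d | ∃ p ∈ V, a = p - z ∧ (inner ℝ a w : ℝ) = 1} = ⊤ := by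
  by_contra hspan
  obtain ⟨e, he, he0⟩ := Submodule.exists_mem_ne_zero_of_ne_bot
    (mt (Submodule.orthogonal_eq_bot_iff).1 hspan)
  have hwD : ∀ p ∈ V, (inner ℝ (p - z) w : ℝ) ≤ 1 := hw.1
  have hev : ∀ᶠ t : ℝ in nhds 0, ∀ p ∈ V, (inner ℝ (p - z) (w + t • e) : ℝ) ≤ 1 := by
    refine (Filter.eventually_all_finset V).2 fun p hp => ?_
    rcases (hwD p hp).eq_or_lt with h | h
    · refine Filter.Eventually.of_forall fun t => ?_
      have : (inner ℝ (p - z) e : ℝ) = 0 :=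
        he _ (Submodule.subset_span ⟨p, hp, rfl, h⟩)
      rw [inner_add_right, inner_smul_right, this, h, mul_zero, add_zero]
    · have hc : Continuous fun t : ℝ => (inner ℝ (p - z) (w + t • e) : ℝ) := by fun_prop
      refine ((hc.tendsto 0).eventually_lt_const (u := 1) (by simpa using h)).mono
        fun t ht => ht.le
  obtain ⟨r, hr, hball⟩ := Metric.eventually_nhds_iff.1 hev
  have h1 := hball (y := r / 2) (by simp [abs_of_pos hr, hr])
  have h2 := hball (y := -(r / 2)) (by simp [abs_of_pos hr, hr])
  have := hw.2 h1 h2 ⟨1 / 2, 1 / 2, by norm_num, by norm_num, by norm_num, by module⟩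
  have h3 : (r / 2) • e = 0 := by simpa using this
  exact he0 ((smul_eq_zero.1 h3).resolve_left (by positivity))

/-- A polytope is the intersection of the halfspaces determined by its facets. -/
theorem mem_of_forall_facet (hd : 1 ≤ d) {P : Set (Euc d)} (hP : IsPolytope P) {y : Euc d}
    (hy : ∀ u, IsFacetNormal P u → ∀ q ∈ exposedFaceAt P u,
      (inner ℝ y u : ℝ) ≤ inner ℝ q u) : y ∈ P := by
  obtain ⟨V, rfl, z, hz⟩ := hP
  set P := convexHull ℝ (V : Set (Euc d)) with hPdef
  have hclosed : IsClosed P := V.finite_toSet.isClosed_convexHull ℝ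
  set D := {w : Euc d | ∀ p ∈ V, (inner ℝ (p - z) w : ℝ) ≤ 1} with hD
  have hDP : ∀ w ∈ D, ∀ p ∈ P, (inner ℝ (p - z) w : ℝ) ≤ 1 := by
    intro w hw p hp
    have hc : Convex ℝ {p : Euc d | (inner ℝ (p - z) w : ℝ) ≤ 1} := by
      have : {p : Euc d | (inner ℝ (p - z) w : ℝ) ≤ 1} =
          {p | innerₛₗ ℝ w p ≤ 1 + inner ℝ w z} := by
        ext p
        simp [inner_sub_left, real_inner_comm]
      rw [this]
      exact convex_halfSpace_le (LinearMap.isLinear _) _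
    exact convexHull_min (fun p hp => hw p hp) hc hp
  have hDeq : D = ⋂ p ∈ V, {w : Euc d | (inner ℝ (p - z) w : ℝ) ≤ 1} := by
    ext; simp [hD]
  have hDconv : Convex ℝ D := by
    rw [hDeq]
    exact convex_iInter₂ fun p _ => convex_halfSpace_le (innerₛₗ ℝ (p - z)).isLinear 1
  have hDclosed : IsClosed D := by
    rw [hDeq]
    exact isClosed_biInter fun p _ => isClosed_le (by fun_prop) continuous_const
  have hDcomp : IsCompact D := by
    obtain ⟨r, hr, hball⟩ := Metric.mem_nhds_iff.1 (mem_interior_iff_mem_nhds.1 hz)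
    refine Metric.isCompact_of_isClosed_isBounded hDclosed
      ((Metric.isBounded_closedBall (x := (0 : Euc d)) (r := 2 / r)).subset fun w hw => ?_)
    rw [mem_closedBall_zero_iff]
    rcases eq_or_ne w 0 with rfl | hw0
    · simp; positivity
    have hn : 0 < ‖w‖ := norm_pos_iff.2 hw0
    have h1 := hDP w hw (z + (r / 2 / ‖w‖) • w) (hball (by
      rw [mem_ball_iff_norm, add_sub_cancel_left, norm_smul, Real.norm_of_nonneg (by positivity),
        div_mul_cancel₀ _ hn.ne']
      linarith))
    rw [add_sub_cancel_left, real_inner_smul_left, real_inner_self_eq_norm_sq] at h1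
    rw [le_div_iff₀ hr]
    field_simp at h1
    linarith
  have hext : ∀ w ∈ D.extremePoints ℝ, (inner ℝ (y - z) w : ℝ) ≤ 1 := by
    intro w hw
    have hspan := span_active_eq_top hw
    set A := {a : Euc d | ∃ p ∈ V, a = p - z ∧ (inner ℝ a w : ℝ) = 1} with hA
    have hAne : A.Nonempty := by
      by_contra hemp
      rw [not_nonempty_iff_eq_empty] at hemp
      rw [hemp, Submodule.span_empty] at hspan
      have h1 : Module.finrank ℝ (⊥ : Submodule ℝ (Euc d)) = d := by
        rw [hspan, finrank_top]; simp
      rw [finrank_bot] at h1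
      omega
    obtain ⟨_, p₀, hp₀, rfl, hp₀w⟩ := hAne
    have hw0 : w ≠ 0 := by
      rintro rfl
      simp at hp₀w
    have hn : 0 < ‖w‖ := norm_pos_iff.2 hw0
    set u := ‖w‖⁻¹ • w with hu
    have hwu : ∀ q : Euc d, (inner ℝ q u : ℝ) = ‖w‖⁻¹ * (inner ℝ (q - z) w + inner ℝ z w) := by
      intro q
      rw [hu, real_inner_smul_right, inner_sub_left, sub_add_cancel]
    have hface : ∀ q ∈ P, (inner ℝ (q - z) w : ℝ) = 1 → q ∈ exposedFaceAt P u := by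
      intro q hq hqw
      refine ⟨hq, fun x hx => ?_⟩
      rw [hwu, hwu, hqw]
      have := hDP w hw.1 x hx
      gcongr
    have hface' : ∀ q ∈ exposedFaceAt P u, (inner ℝ (q - z) w : ℝ) = 1 := by
      intro q hq
      refine (hDP w hw.1 q hq.1).antisymm ?_
      have := hq.2 p₀ (subset_convexHull ℝ _ hp₀)
      rw [hwu, hwu, hp₀w] at this
      have := le_of_mul_le_mul_left this (inv_pos.2 hn)
      linarith
    have hp₀F := hface p₀ (subset_convexHull ℝ _ hp₀) hp₀w
    set W := (affineSpan ℝ (exposedFaceAt P u)).direction with hW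
    have hsup : W ⊔ Submodule.span ℝ {p₀ - z} = ⊤ := by
      rw [eq_top_iff, ← hspan, Submodule.span_le]
      rintro _ ⟨p, hp, rfl, hpw⟩
      have h1 : p - z = (p - p₀) + (p₀ - z) := by abel
      rw [h1]
      refine Submodule.add_mem_sup ?_ (Submodule.mem_span_singleton_self _)
      exact AffineSubspace.vsub_mem_direction
        (subset_affineSpan ℝ _ (hface p (subset_convexHull ℝ _ hp) hpw))
        (subset_affineSpan ℝ _ hp₀F)
    have hperp : W ≤ (Submodule.span ℝ {w})ᗮ := by
      rw [hW, direction_affineSpan, vectorSpan_def, Submodule.span_le]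
      rintro _ ⟨a, ha, b, hb, rfl⟩
      rw [SetLike.mem_coe, Submodule.mem_orthogonal_singleton_iff_inner_left]
      have h1 := hface' a ha
      have h2 := hface' b hb
      rw [inner_sub_left] at h1 h2
      change (inner ℝ (a - b) w : ℝ) = 0
      rw [inner_sub_left]
      linarith
    have hfr : Module.finrank ℝ W = d - 1 := by
      have h1 := Submodule.finrank_mono hperp
      have h2 := (Submodule.span ℝ {w}).finrank_add_finrank_orthogonal
      rw [finrank_span_singleton hw0, finrank_euclideanSpace_fin] at h2
      have h3 := Submodule.finrank_add_le_finrank_add_finrank W (Submodule.span ℝ {p₀ - z})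
      rw [hsup, finrank_top, finrank_euclideanSpace_fin] at h3
      have h4 := finrank_span_le_card (R := ℝ) ({p₀ - z} : Set (Euc d))
      simp only [toFinset_singleton, Finset.card_singleton] at h4
      omega
    have hun : ‖u‖ = 1 := by
      rw [hu, norm_smul, norm_inv, norm_norm, inv_mul_cancel₀ hn.ne']
    have h5 := hy u ⟨hun, hfr⟩ p₀ hp₀F
    rw [hwu, hwu, hp₀w] at h5
    have := le_of_mul_le_mul_left h5 (inv_pos.2 hn)
    linarith
  have hall : ∀ w ∈ D, (inner ℝ (y - z) w : ℝ) ≤ 1 := by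
    intro w hw
    rw [← closure_convexHull_extremePoints hDcomp hDconv] at hw
    refine closure_minimal (convexHull_min (t := {w : Euc d | (inner ℝ (y - z) w : ℝ) ≤ 1})
      hext ?_) (isClosed_le (by fun_prop) continuous_const) hw
    exact convex_halfSpace_le (innerₛₗ ℝ (y - z)).isLinear 1
  by_contra hyP
  obtain ⟨f, r, hfP, hfy⟩ := geometric_hahn_banach_closed_point (convex_convexHull ℝ _) hclosed hyP
  have hrz : 0 < r - f z := sub_pos.2 (hfP z (interior_subset hz))
  set e := (InnerProductSpace.toDual ℝ (Euc d)).symm f with he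
  have hfe : ∀ x, (inner ℝ x e : ℝ) = f x := fun x => by
    rw [real_inner_comm, he, InnerProductSpace.toDual_symm_apply]
  have h1 := hall ((r - f z)⁻¹ • e) fun p hp => by
    rw [real_inner_smul_right, hfe, map_sub, inv_mul_le_iff₀ hrz, mul_one]
    linarith [hfP p (subset_convexHull ℝ _ hp)]
  rw [real_inner_smul_right, hfe, map_sub, inv_mul_le_iff₀ hrz, mul_one] at h1
  linarith

theorem IsPolytope.isCompact {P : Set (Euc d)} (hP : IsPolytope P) : IsCompact P := by
  obtain ⟨V, rfl, -⟩ := hP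
  exact V.finite_toSet.isCompact_convexHull ℝ

theorem IsPolytope.convex {P : Set (Euc d)} (hP : IsPolytope P) : Convex ℝ P := by
  obtain ⟨V, rfl, -⟩ := hP
  exact convex_convexHull ℝ _

theorem mem_homo {P : Set (Euc d)} {x y : Euc d} {τ : ℝ} :
    y ∈ homo x τ P ↔ ∃ p ∈ P, x + τ • p = y := by
  simp [homo, singleton_add, mem_smul_set, eq_neg_add_iff_add_eq]

/-- In a facet direction of width `inner q u - inner r u`, no member of a weakly non-separable
family protrudes far beyond the weighted mean of the family. -/
theorem WNS.sum_mul_sub_le {P : Set (Euc d)} {n : ℕ} {x : Fin n → Euc d} {τ : Fin n → ℝ}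
    (hWNS : WNS P x τ) (hτ : ∀ i, 0 < τ i) {u q r : Euc d} (hu : IsFacetNormal P u)
    (hq : q ∈ exposedFaceAt P u) (hrP : r ∈ P)
    (hr : ∀ p ∈ P, (inner ℝ r u : ℝ) ≤ inner ℝ p u) (k : Fin n) :
    ∑ i, τ i * ((inner ℝ (x k) u + τ k * inner ℝ q u) - (inner ℝ (x i) u + τ i * inner ℝ q u)) ≤
      (inner ℝ q u - inner ℝ r u) * ((∑ i, τ i) ^ 2 - ∑ i, τ i ^ 2) / 2 := by
  refine sum_mul_sub_le_of_cover (b := fun i => inner ℝ (x i) u + τ i * inner ℝ q u)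
    (fun i => (hτ i).le) (sub_nonneg.2 (hq.2 r hrP)) fun i t ht => ?_
  have huu : (inner ℝ u u : ℝ) = 1 := by rw [real_inner_self_eq_norm_sq, hu.1, one_pow]
  have hu0 : u ≠ 0 := by
    rintro rfl
    simp at huu
  have hmem : ∀ j, x j + τ j • q ∈ convexHull ℝ (⋃ i, homo (x i) (τ i) P) := fun j =>
    subset_convexHull ℝ _ (mem_iUnion.2 ⟨j, mem_homo.2 ⟨q, hq.1, rfl⟩⟩)
  have hval : ∀ j, (inner ℝ (x j + τ j • q) u : ℝ) = inner ℝ (x j) u + τ j * inner ℝ q u :=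
    fun j => by rw [inner_add_left, real_inner_smul_left]
  have hpar : HypParallelToFacet P {y : Euc d | (inner ℝ y u : ℝ) = t} := by
    refine ⟨u, hu, ((inner ℝ q u : ℝ) - t) • u, fun a ha => ⟨a - ((inner ℝ q u : ℝ) - t) • u, ?_,
      by simp⟩⟩
    have : (inner ℝ a u : ℝ) = inner ℝ q u := (hq.2 a ha.1).antisymm (ha.2 q hq.1)
    change (inner ℝ (a - ((inner ℝ q u : ℝ) - t) • u) u : ℝ) = t
    rw [inner_sub_left, real_inner_smul_left, huu, this]
    ring
  have hmeet : ({y : Euc d | (inner ℝ y u : ℝ) = t} ∩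
      convexHull ℝ (⋃ i, homo (x i) (τ i) P)).Nonempty := by
    have hpos := sub_pos.2 (ht.1.trans_le ht.2)
    set β : Fin n → ℝ := fun i => inner ℝ (x i) u + τ i * inner ℝ q u with hβ
    set θ := (t - β i) / (β k - β i) with hθ
    have hθmul : θ * (β k - β i) = t - β i := div_mul_cancel₀ _ hpos.ne'
    refine ⟨(1 - θ) • (x i + τ i • q) + θ • (x k + τ k • q), ?_,
      convex_convexHull ℝ _ (hmem i) (hmem k) ?_ ?_ (by ring)⟩
    · change (inner ℝ _ u : ℝ) = t
      rw [inner_add_left, real_inner_smul_left, real_inner_smul_left, hval, hval]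
      change (1 - θ) * β i + θ * β k = t
      linarith
    · rw [sub_nonneg, hθ, div_le_one hpos]
      linarith [ht.2]
    · exact div_nonneg (sub_nonneg.2 ht.1.le) hpos.le
  obtain ⟨j, y, hyt, hy⟩ := hWNS _ ⟨u, hu0, t, rfl⟩ hpar hmeet
  obtain ⟨p, hp, rfl⟩ := mem_homo.1 hy
  have hyt' : (inner ℝ (x j) u : ℝ) + τ j * inner ℝ p u = t := by
    rw [← real_inner_smul_left, ← inner_add_left]
    exact hyt
  refine ⟨j, ?_, ?_⟩
  · have := mul_le_mul_of_nonneg_left (hr p hp) (hτ j).le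
    linarith
  · have := mul_le_mul_of_nonneg_left (hq.2 p hp) (hτ j).le
    linarith

/-- If a translate of `-P` lies in `s • P`, then a weakly non-separable family of homothets of `P`
is covered by a homothet whose ratio is `(s + 1) / 2` times the sum of the ratios. -/
theorem WNS.exists_cover {P : Set (Euc d)} {n : ℕ} {x : Fin n → Euc d} {τ : Fin n → ℝ}
    (hWNS : WNS P x τ) (hd : 1 ≤ d) (hP : IsPolytope P) (hτ : ∀ i, 0 < τ i)
    (hT : 0 < ∑ i, τ i) {s : ℝ} (hs : 1 ≤ s) {c : Euc d} (hc : ∀ p ∈ P, c - p ∈ s • P) :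
    ∃ C : Euc d, (⋃ i, homo (x i) (τ i) P) ⊆ homo C ((∑ i, τ i) * ((s + 1) / 2)) P := by
  set T := ∑ i, τ i with hTdef
  set Q := ∑ i, τ i ^ 2 with hQ
  have hQ0 : 0 ≤ Q := Finset.sum_nonneg fun i _ => sq_nonneg _
  have hQT : Q ≤ T ^ 2 := by
    rw [hQ, hTdef]
    exact Finset.sum_sq_le_sq_sum_of_nonneg fun i _ => (hτ i).le
  set z : Euc d := (s + 1)⁻¹ • c with hz
  have hcz : c = (s + 1) • z := by rw [hz, smul_inv_smul₀ (by linarith)]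
  set μ := T * ((s + 1) / 2) with hμ
  have hμ0 : 0 < μ := mul_pos hT (by linarith)
  set C : Euc d := T⁻¹ • (∑ i, τ i • x i + Q • z) - μ • z with hC
  refine ⟨C, iUnion_subset fun k y hy => ?_⟩
  obtain ⟨p, hp, rfl⟩ := mem_homo.1 hy
  refine mem_homo.2 ⟨μ⁻¹ • (x k + τ k • p - C), ?_, by rw [smul_inv_smul₀ hμ0.ne']; abel⟩
  refine mem_of_forall_facet hd hP fun u hu q hq => ?_
  obtain ⟨r, hrP, hr⟩ := hP.isCompact.exists_isMinOn ⟨p, hp⟩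
    (f := fun y : Euc d => (inner ℝ y u : ℝ)) (by fun_prop)
  have hmain := hWNS.sum_mul_sub_le hτ hu hq hrP (fun p hp => hr hp) k
  obtain ⟨q', hq', hq'c⟩ := hc r hrP
  have hasym : (s + 1) * (inner ℝ z u : ℝ) - inner ℝ r u ≤ s * inner ℝ q u := by
    rw [← real_inner_smul_left, ← hcz, ← inner_sub_left]
    have : s • q' = c - r := hq'c
    rw [← this, real_inner_smul_left]
    exact mul_le_mul_of_nonneg_left (hq.2 q' hq') (by linarith)
  have hpq := mul_le_mul_of_nonneg_left (hq.2 p hp) (hτ k).le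
  have hrq : (inner ℝ r u : ℝ) ≤ inner ℝ q u := hq.2 r hrP
  rw [real_inner_smul_left, inv_mul_le_iff₀ hμ0, inner_sub_left, inner_add_left,
    real_inner_smul_left, hC, inner_sub_left, real_inner_smul_left, real_inner_smul_left,
    inner_add_left, sum_inner, real_inner_smul_left]
  simp only [real_inner_smul_left]
  have hsum : ∑ i, τ i * ((inner ℝ (x k) u + τ k * inner ℝ q u) -
      (inner ℝ (x i) u + τ i * inner ℝ q u)) =
      T * (inner ℝ (x k) u + τ k * inner ℝ q u) -
        (∑ i, τ i * (inner ℝ (x i) u : ℝ) + Q * inner ℝ q u) := by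
    rw [hTdef, hQ, Finset.sum_mul, Finset.sum_mul, ← Finset.sum_add_distrib,
      ← Finset.sum_sub_distrib]
    exact Finset.sum_congr rfl fun i _ => by ring
  rw [hsum, ← hTdef, ← hQ] at hmain
  set h : ℝ := inner ℝ q u
  set ρ : ℝ := inner ℝ r u
  set ζ : ℝ := inner ℝ z u
  set X : ℝ := ∑ i, τ i * (inner ℝ (x i) u : ℝ)
  have hh : 0 ≤ h - ζ := by nlinarith
  have hbound : T * (inner ℝ (x k) u + τ k * h) ≤ X + Q * ζ + T * (μ * (h - ζ)) := by
    have h1 := mul_nonneg (sub_nonneg.2 hQT)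
      (by linarith : 0 ≤ s * (h - ζ) - (ζ - ρ))
    have h2 := mul_nonneg (mul_nonneg hQ0 (sub_nonneg.2 hs)) hh
    rw [hμ]
    nlinarith
  have hdiv : inner ℝ (x k) u + τ k * h ≤ T⁻¹ * (X + Q * ζ) + μ * (h - ζ) := by
    rw [← mul_le_mul_iff_right₀ hT, mul_add T (T⁻¹ * _), mul_inv_cancel_left₀ hT.ne']
    exact hbound
  linarith

/-- stability — if the minimal covering homothety ratio of a
WNS-family of homothets of `P` is close to `(d+1)/2`, then `P` is close to a
simplex in the Banach–Mazur distance. -/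
theorem stmt_11 (d n : ℕ) (hd : 2 ≤ d) (hn : 1 ≤ n)
    (ε : ℝ) (hε0 : 0 < ε) (hε1 : ε < 1 / (16 * ((d : ℝ) + 1)))
    (P : Set (Euc d)) (hP : IsPolytope P)
    (x : Fin n → Euc d) (τ : Fin n → ℝ) (hτ : ∀ i, 0 < τ i)
    (hWNS : WNS P x τ)
    (hmin : ∀ (c : Euc d) (μ : ℝ), 0 < μ →
      (⋃ i, homo (x i) (τ i) P) ⊆ homo c μ P →
      (((d : ℝ) + 1) / 2 - ε) * ∑ i, τ i ≤ μ) :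
    ∀ S : Set (Euc d), IsSimplex d S →
      bmDist P S ≤ 1 + 16 * ((d : ℝ) + 1) * ε := by
  intro S hS
  have hd1 : (0 : ℝ) < d + 1 := by positivity
  have hd2 : (2 : ℝ) ≤ d := by exact_mod_cast hd
  have hε : 16 * ((d : ℝ) + 1) * ε < 1 := by
    rw [lt_div_iff₀ (by positivity)] at hε1
    linarith
  have hε2 : ε < 1 / 48 := by nlinarith
  have hPne : P.Nonempty := by
    obtain ⟨V, -, hint⟩ := hP
    exact hint.mono interior_subset
  have hTpos : 0 < ∑ i, τ i :=
    Finset.sum_pos (fun i _ => hτ i) ⟨⟨0, hn⟩, Finset.mem_univ _⟩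
  have hbm : bmDist P S ≤ 1 + 4 * (d + 1) * (4 * ε) := by
    refine bmDist_le_of_no_translate hP.isCompact hP.convex hPne hS (by positivity) (by linarith)
      (by linarith) ?_
    by_contra! hcon
    obtain ⟨c, hc⟩ := hcon
    obtain ⟨C, hC⟩ := hWNS.exists_cover (by omega) hP hτ hTpos (by linarith) hc
    have := hmin C _ (by apply mul_pos hTpos; linarith) hC
    nlinarith
  linarith

end
end

section
/- Let d ≥ 2 and n ≥ 1, and let C_d = [0,1]^d be the unit cube in ℝ^d. Then there exists a weakly non-separable family ℱ₀ of n translates of C_d such that: (a) the smallest axis-parallel box containing ⋃ℱ₀ is a translate of [0,n]^d; and (b) for every weakly non-separable family ℱ of n translates of C_d, the Lebesgue measure of conv(⋃ℱ) is at most the Lebesgue measure of conv(⋃ℱ₀). -/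
open Set Metric Pointwise MeasureTheory

noncomputable section

variable {d : ℕ}

/-- A vector whose increasing rearrangement has all consecutive gaps at most `1` lies, up to adding
a constant, in the permutohedron spanned by the rearrangements of `(0, …, n - 1)`. -/
lemma exists_sub_mem_convexHull_perm {n : ℕ} (hn : 1 ≤ n) (f : Fin n → ℝ)
    (τ : Equiv.Perm (Fin n)) (hf : Monotone (f ∘ τ))
    (hgap : Monotone fun i : Fin n => (i : ℝ) - f (τ i)) :
    ∃ c : ℝ, (fun k => f k - c) ∈
      convexHull ℝ (Set.range fun (σ : Equiv.Perm (Fin n)) (k : Fin n) => ((σ k : ℕ) : ℝ)) := by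
  have hn0 : (0 : ℝ) < n := by exact_mod_cast hn
  obtain ⟨c, hc⟩ : ∃ c : ℝ, ∑ i : Fin n, ((i : ℝ) - (f (τ i) - c)) = 0 := by
    refine ⟨-(∑ i : Fin n, ((i : ℝ) - f (τ i))) / n, ?_⟩
    simp only [sub_sub_eq_add_sub, add_sub_right_comm, Finset.sum_add_distrib, Finset.sum_const,
      Finset.card_univ, Fintype.card_fin, nsmul_eq_mul]
    field_simp
    ring
  refine ⟨c, ?_⟩
  by_contra hmem
  obtain ⟨L, u, hL, hu⟩ := geometric_hahn_banach_closed_point (convex_convexHull ℝ _)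
    ((Set.finite_range _).isCompact_convexHull ℝ).isClosed hmem
  set w : Fin n → ℝ := fun i => L fun j => if i = j then 1 else 0 with hw
  have hLw : ∀ x : Fin n → ℝ, L x = ∑ i, x i * w i := fun x => by
    simpa [hw] using LinearMap.pi_apply_eq_sum_univ L.toLinearMap x
  set ρ := Tuple.sort w
  have hρ : Monotone (w ∘ ρ) := Tuple.monotone_sort w
  have hperm := hL _ (subset_convexHull ℝ _ ⟨ρ.symm, rfl⟩)
  rw [hLw] at hperm hu
  rw [← Equiv.sum_comp ρ] at hperm
  rw [← Equiv.sum_comp τ] at hu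
  simp only [Equiv.symm_apply_apply] at hperm
  have hrearr : ∑ i, (f (τ i) - c) * w (τ i) ≤ ∑ i, (f (τ i) - c) * w (ρ i) := by
    have hmono : Monotone fun i => f (τ i) - c := fun i j hij => sub_le_sub_right (hf hij) c
    simpa using (hmono.monovary hρ).sum_mul_comp_perm_le_sum_mul (σ := τ.trans ρ.symm)
  have hcheb : 0 ≤ ∑ i : Fin n, ((i : ℝ) - (f (τ i) - c)) * w (ρ i) := by
    have hmono : Monotone fun i : Fin n => (i : ℝ) - (f (τ i) - c) := fun i j hij => by
      have := hgap hij
      simp only at this ⊢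
      linarith
    have := (hmono.monovary hρ).sum_mul_sum_le_card_mul_sum
    rw [hc, zero_mul, Fintype.card_fin] at this
    exact nonneg_of_mul_nonneg_right this hn0
  simp only [sub_mul (_ : ℝ) (f _ - c), Finset.sum_sub_distrib] at hcheb
  linarith

/-- The set of `t` such that inserting `t` as the `j`-th coordinate of `y` gives a point of `K`. -/
def fiberAt {m : ℕ} (j : Fin (m + 1)) (K : Set (Euc (m + 1))) (y : Fin m → ℝ) : Set ℝ :=
  {t | (WithLp.toLp 2 (j.insertNth t y : Fin (m + 1) → ℝ) : Euc (m + 1)) ∈ K}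

lemma volume_eq_lintegral_fiberAt {m : ℕ} (j : Fin (m + 1)) {K : Set (Euc (m + 1))}
    (hK : MeasurableSet K) :
    volume K = ∫⁻ y : Fin m → ℝ, volume (fiberAt j K y) := by
  have h1 := PiLp.volume_preserving_toLp (Fin (m + 1))
  have h2 := (volume_preserving_piFinSuccAbove (fun _ : Fin (m + 1) => ℝ) j).symm
  have h3 := h1.comp h2
  rw [← h3.measure_preimage hK.nullMeasurableSet, Measure.volume_eq_prod,
    Measure.prod_apply_symm (h3.measurable hK)]
  rfl

lemma measurable_volume_fiberAt {m : ℕ} (j : Fin (m + 1)) {K : Set (Euc (m + 1))}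
    (hK : MeasurableSet K) : Measurable fun y : Fin m → ℝ => volume (fiberAt j K y) := by
  have h1 := PiLp.volume_preserving_toLp (Fin (m + 1))
  have h2 := (volume_preserving_piFinSuccAbove (fun _ : Fin (m + 1) => ℝ) j).symm
  exact measurable_measure_prodMk_right ((h1.comp h2).measurable hK)

lemma isCompact_fiberAt {m : ℕ} (j : Fin (m + 1)) {K : Set (Euc (m + 1))} (hK : IsCompact K)
    (y : Fin m → ℝ) : IsCompact (fiberAt j K y) := by
  have hcont : Continuous fun t : ℝ =>
      (WithLp.toLp 2 (j.insertNth t y : Fin (m + 1) → ℝ) : Euc (m + 1)) :=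
    (PiLp.continuous_toLp 2 _).comp (Continuous.finInsertNth j continuous_id continuous_const)
  refine (hK.image (f := fun x : Euc (m + 1) => x j) (by fun_prop)).of_isClosed_subset
    (hK.isClosed.preimage hcont) fun t ht => ⟨_, ht, by simp⟩

lemma convex_fiberAt {m : ℕ} (j : Fin (m + 1)) {K : Set (Euc (m + 1))} (hK : Convex ℝ K)
    (y : Fin m → ℝ) : Convex ℝ (fiberAt j K y) := by
  intro s hs t ht a b ha hb hab
  have := hK hs ht ha hb hab
  simp only [fiberAt, mem_ofPred_eq]
  convert this using 1
  ext i
  induction i using Fin.succAboveCases j with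
  | x => simp
  | p i => simp [← add_mul, hab]

lemma volume_le_of_subset_combination {F G H : Set ℝ} (hG : IsCompact G) (hG' : Convex ℝ G)
    (hH : IsCompact H) (hH' : Convex ℝ H) {a b : ℝ} (ha : 0 ≤ a) (hb : 0 ≤ b)
    (hF : ∀ t ∈ F, ∃ u ∈ G, ∃ v ∈ H, t = a * u + b * v) :
    volume F ≤ ENNReal.ofReal a * volume G + ENNReal.ofReal b * volume H := by
  rcases F.eq_empty_or_nonempty with rfl | ⟨t, ht⟩
  · simp
  obtain ⟨u, hu, v, hv, -⟩ := hF t ht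
  have hGI := eq_Icc_of_connected_compact ⟨⟨u, hu⟩, hG'.isPreconnected⟩ hG
  have hHI := eq_Icc_of_connected_compact ⟨⟨v, hv⟩, hH'.isPreconnected⟩ hH
  generalize sInf G = g at hGI
  generalize sSup G = g' at hGI
  generalize sInf H = h at hHI
  generalize sSup H = h' at hHI
  subst hGI hHI
  have hsub : F ⊆ Set.Icc (a * g + b * h) (a * g' + b * h') := by
    intro s hs
    obtain ⟨x, hx, y, hy, rfl⟩ := hF s hs
    exact ⟨add_le_add (mul_le_mul_of_nonneg_left hx.1 ha) (mul_le_mul_of_nonneg_left hy.1 hb),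
      add_le_add (mul_le_mul_of_nonneg_left hx.2 ha) (mul_le_mul_of_nonneg_left hy.2 hb)⟩
  refine (measure_mono hsub).trans ?_
  rw [Real.volume_Icc, Real.volume_Icc, Real.volume_Icc, ← ENNReal.ofReal_mul ha,
    ← ENNReal.ofReal_mul hb, ← ENNReal.ofReal_add]
  · exact (congrArg ENNReal.ofReal (by ring)).le
  · exact mul_nonneg ha (sub_nonneg.2 (hu.1.trans hu.2))
  · exact mul_nonneg hb (sub_nonneg.2 (hv.1.trans hv.2))

/-- If every point of `K` is the combination `a • u + b • v` of points `u ∈ A`, `v ∈ B` on the line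
through it in direction `j`, then `volume K ≤ a * volume A + b * volume B`. -/
lemma volume_le_of_fiberwise_combination (j : Fin d) {K A B : Set (Euc d)}
    (hK : IsCompact K) (hA : IsCompact A) (hA' : Convex ℝ A) (hB : IsCompact B)
    (hB' : Convex ℝ B) {a b : ℝ} (ha : 0 ≤ a) (hb : 0 ≤ b)
    (hKAB : ∀ x ∈ K, ∃ u ∈ A, ∃ v ∈ B, x j = a * u j + b * v j ∧
      ∀ i, i ≠ j → u i = x i ∧ v i = x i) :
    volume K ≤ ENNReal.ofReal a * volume A + ENNReal.ofReal b * volume B := by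
  obtain _ | m := d
  · exact j.elim0
  rw [volume_eq_lintegral_fiberAt j hK.measurableSet, volume_eq_lintegral_fiberAt j hA.measurableSet,
    volume_eq_lintegral_fiberAt j hB.measurableSet,
    ← lintegral_const_mul _ (measurable_volume_fiberAt j hA.measurableSet),
    ← lintegral_const_mul _ (measurable_volume_fiberAt j hB.measurableSet),
    ← lintegral_add_left ((measurable_volume_fiberAt j hA.measurableSet).const_mul _)]
  refine lintegral_mono fun y => volume_le_of_subset_combination (isCompact_fiberAt j hA y)
    (convex_fiberAt j hA' y) (isCompact_fiberAt j hB y) (convex_fiberAt j hB' y) ha hb ?_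
  intro t ht
  obtain ⟨u, hu, v, hv, hj, hi⟩ := hKAB _ ht
  have key : ∀ z : Euc (m + 1), (∀ i, i ≠ j →
      z i = (WithLp.toLp 2 (j.insertNth t y : Fin (m + 1) → ℝ) : Euc (m + 1)) i) →
      (WithLp.toLp 2 (j.insertNth (z j) y : Fin (m + 1) → ℝ) : Euc (m + 1)) = z := by
    intro z hz
    ext i
    induction i using Fin.succAboveCases j with
    | x => simp
    | p i => simpa using (hz _ (Fin.succAbove_ne j i)).symm
  refine ⟨u j, ?_, v j, ?_, by simpa using hj⟩
  · rw [fiberAt, mem_ofPred_eq, key u fun i h => (hi i h).1]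
    exact hu
  · rw [fiberAt, mem_ofPred_eq, key v fun i h => (hi i h).2]
    exact hv

/-- The convex hull of the translates of the unit cube by the vectors `p k`. -/
def cubeHull {d n : ℕ} (p : Fin n → Euc d) : Set (Euc d) :=
  convexHull ℝ (⋃ k, {p k} + unitCube d)

lemma convex_unitCube (d : ℕ) : Convex ℝ (unitCube d) := by
  intro x hx y hy a b ha hb hab i
  exact convex_Icc (0 : ℝ) 1 (hx i) (hy i) ha hb hab

lemma isCompact_unitCube (d : ℕ) : IsCompact (unitCube d) := by
  have h : unitCube d = WithLp.toLp 2 '' Set.pi Set.univ fun _ : Fin d => Set.Icc (0 : ℝ) 1 := by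
    ext x
    refine ⟨fun hx => ⟨x.ofLp, fun i _ => hx i, rfl⟩, ?_⟩
    rintro ⟨y, hy, rfl⟩ i
    exact hy i trivial
  rw [h]
  exact (isCompact_univ_pi fun _ => isCompact_Icc).image (PiLp.continuous_toLp 2 _)

lemma cubeHull_eq_add {n : ℕ} (p : Fin n → Euc d) :
    cubeHull p = convexHull ℝ (Set.range p) + unitCube d := by
  rw [cubeHull, ← Set.iUnion_add, Set.iUnion_singleton_eq_range, convexHull_add,
    (convex_unitCube d).convexHull_eq]

lemma isCompact_cubeHull {n : ℕ} (p : Fin n → Euc d) : IsCompact (cubeHull p) := by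
  rw [cubeHull_eq_add]
  exact ((Set.finite_range p).isCompact_convexHull ℝ).add (isCompact_unitCube d)

lemma convex_cubeHull {n : ℕ} (p : Fin n → Euc d) : Convex ℝ (cubeHull p) :=
  convex_convexHull ℝ _

lemma add_mem_cubeHull {n : ℕ} (p : Fin n → Euc d) (k : Fin n) {c : Euc d} (hc : c ∈ unitCube d) :
    p k + c ∈ cubeHull p :=
  subset_convexHull ℝ _ (mem_iUnion.2 ⟨k, add_mem_add rfl hc⟩)

lemma cubeHull_subset {n : ℕ} {p : Fin n → Euc d} {S : Set (Euc d)} (hS : Convex ℝ S)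
    (h : ∀ k, ∀ c ∈ unitCube d, p k + c ∈ S) : cubeHull p ⊆ S := by
  refine convexHull_min (iUnion_subset fun k => ?_) hS
  rintro _ ⟨_, rfl, c, hc, rfl⟩
  exact h k c hc

lemma volume_cubeHull_add_const {n : ℕ} (p : Fin n → Euc d) (v : Euc d) :
    volume (cubeHull fun k => v + p k) = volume (cubeHull p) := by
  have h : (cubeHull fun k => v + p k) = v +ᵥ cubeHull p := by
    have hr : (Set.range fun k => v + p k) = {v} + Set.range p := by
      rw [singleton_add, ← Set.range_comp]
      rfl
    rw [cubeHull_eq_add, cubeHull_eq_add, hr, convexHull_add, convexHull_singleton, add_assoc,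
      singleton_add]
    rfl
  rw [h, measure_vadd]

/-- Replace the `j`-th coordinates of the points `p k` by the values `f k`. -/
def setCoord {d n : ℕ} (j : Fin d) (p : Fin n → Euc d) (f : Fin n → ℝ) : Fin n → Euc d :=
  fun k => WithLp.toLp 2 (Function.update (p k).ofLp j (f k))

@[simp]
lemma setCoord_apply_self {n : ℕ} (j : Fin d) (p : Fin n → Euc d) (f : Fin n → ℝ) (k : Fin n) :
    setCoord j p f k j = f k := by
  simp [setCoord]

lemma setCoord_apply_of_ne {n : ℕ} {i j : Fin d} (h : i ≠ j) (p : Fin n → Euc d) (f : Fin n → ℝ)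
    (k : Fin n) : setCoord j p f k i = p k i := by
  simp [setCoord, h]

/-- The volume of the hull is a convex function of the `j`-th coordinates of the cubes. -/
lemma convexOn_volume_cubeHull_setCoord {n : ℕ} (j : Fin d) (p : Fin n → Euc d) :
    ConvexOn ℝ Set.univ fun f : Fin n → ℝ => (volume (cubeHull (setCoord j p f))).toReal := by
  refine ⟨convex_univ, fun g _ h _ a b ha hb hab => ?_⟩
  have hg := (isCompact_cubeHull (setCoord j p g)).measure_lt_top (μ := volume)
  have hh := (isCompact_cubeHull (setCoord j p h)).measure_lt_top (μ := volume)
  have hle : volume (cubeHull (setCoord j p (a • g + b • h))) ≤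
      ENNReal.ofReal a * volume (cubeHull (setCoord j p g)) +
        ENNReal.ofReal b * volume (cubeHull (setCoord j p h)) := by
    refine volume_le_of_fiberwise_combination j (isCompact_cubeHull _) (isCompact_cubeHull _)
      (convex_cubeHull _) (isCompact_cubeHull _) (convex_cubeHull _) ha hb ?_
    refine cubeHull_subset (S := {x | ∃ u ∈ cubeHull (setCoord j p g),
      ∃ v ∈ cubeHull (setCoord j p h), x j = a * u j + b * v j ∧
        ∀ i, i ≠ j → u i = x i ∧ v i = x i}) ?_ ?_
    · rintro x ⟨u, hu, v, hv, hxj, hxi⟩ y ⟨u', hu', v', hv', hyj, hyi⟩ s t hs ht hst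
      refine ⟨s • u + t • u', convex_cubeHull _ hu hu' hs ht hst,
        s • v + t • v', convex_cubeHull _ hv hv' hs ht hst, ?_, fun i hi => ?_⟩
      · simp only [PiLp.add_apply, PiLp.smul_apply, smul_eq_mul, hxj, hyj]
        ring
      · simp [(hxi i hi).1, (hxi i hi).2, (hyi i hi).1, (hyi i hi).2]
    · intro k c hc
      refine ⟨_, add_mem_cubeHull _ k hc, _, add_mem_cubeHull _ k hc, ?_, fun i hi => ?_⟩
      · simp only [PiLp.add_apply, setCoord_apply_self, Pi.add_apply, Pi.smul_apply, smul_eq_mul]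
        linear_combination (-c j) * hab
      · simp [setCoord_apply_of_ne hi]
  have hfin : ENNReal.ofReal a * volume (cubeHull (setCoord j p g)) ≠ ⊤ :=
    ENNReal.mul_ne_top ENNReal.ofReal_ne_top hg.ne
  have hfin' : ENNReal.ofReal b * volume (cubeHull (setCoord j p h)) ≠ ⊤ :=
    ENNReal.mul_ne_top ENNReal.ofReal_ne_top hh.ne
  have := ENNReal.toReal_mono (ENNReal.add_ne_top.2 ⟨hfin, hfin'⟩) hle
  rwa [ENNReal.toReal_add hfin hfin', ENNReal.toReal_mul, ENNReal.toReal_mul,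
    ENNReal.toReal_ofReal ha, ENNReal.toReal_ofReal hb] at this

/-- In a weakly non-separable family, consecutive `j`-th coordinates differ by at most `1`. -/
lemma CubeWNS.monotone_sub_sort {n : ℕ} {p : Fin n → Euc d} (hp : CubeWNS p) (j : Fin d) :
    Monotone fun i : Fin n => (i : ℝ) - p (Tuple.sort (fun k => p k j) i) j := by
  have hmono := Tuple.monotone_sort fun k => p k j
  set τ := Tuple.sort fun k => p k j
  obtain _ | n := n
  · exact fun i => i.elim0
  rw [Fin.monotone_iff_le_succ]
  intro i
  by_contra! hlt
  simp only [Fin.val_succ, Fin.val_castSucc, Nat.cast_add, Nat.cast_one] at hlt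
  set x := p (τ i.castSucc) j with hx
  set y := p (τ i.succ) j with hy
  have hzero : (0 : Euc d) ∈ unitCube d := fun _ => by simp
  have hmem : ∀ k, p k ∈ cubeHull p := fun k => by simpa using add_mem_cubeHull p k hzero
  have hconn : Set.Icc x y ⊆ (fun z : Euc d => z j) '' cubeHull p :=
    ((convex_cubeHull p).isPreconnected.image _
      (by fun_prop : Continuous fun z : Euc d => z j).continuousOn).Icc_subset
      ⟨_, hmem _, rfl⟩ ⟨_, hmem _, rfl⟩
  obtain ⟨z, hz, hzj⟩ := hconn (show (x + 1 + y) / 2 ∈ Set.Icc x y by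
    constructor <;> linarith)
  obtain ⟨k, w, hw, _, rfl, c, hc, rfl⟩ := hp j ((x + 1 + y) / 2) ⟨z, hzj, hz⟩
  have hwj : p k j + c j = (x + 1 + y) / 2 := hw
  have hcj := hc j
  rcases le_or_gt (τ.symm k) i.castSucc with h | h
  · have := hmono h
    simp only [Function.comp_apply, Equiv.apply_symm_apply] at this
    linarith [hcj.2]
  · have := hmono (Fin.castSucc_lt_iff_succ_le.1 h)
    simp only [Function.comp_apply, Equiv.apply_symm_apply] at this
    linarith [hcj.1]

lemma exists_perm_volume_le_setCoord {n : ℕ} (hn : 1 ≤ n) (j : Fin d) (p : Fin n → Euc d)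
    (hp : Monotone fun i : Fin n => (i : ℝ) - p (Tuple.sort (fun k => p k j) i) j) :
    ∃ σ : Equiv.Perm (Fin n),
      volume (cubeHull p) ≤ volume (cubeHull (setCoord j p fun k => ((σ k : ℕ) : ℝ))) := by
  obtain ⟨c, hc⟩ := exists_sub_mem_convexHull_perm hn (fun k => p k j) _
    (Tuple.monotone_sort fun k => p k j) hp
  obtain ⟨_, ⟨σ, rfl⟩, hσ⟩ := (convexOn_volume_cubeHull_setCoord j p).exists_ge_of_mem_convexHull
    (Set.subset_univ _) hc
  refine ⟨σ, ?_⟩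
  have htrans : p = fun k => EuclideanSpace.single j c + setCoord j p (fun k => p k j - c) k := by
    ext k i
    by_cases h : i = j
    · subst h
      simp
    · simp [setCoord_apply_of_ne h, h]
  rw [htrans, volume_cubeHull_add_const, ← htrans]
  exact (ENNReal.toReal_le_toReal (isCompact_cubeHull _).measure_lt_top.ne
    (isCompact_cubeHull _).measure_lt_top.ne).1 hσ

/-- The family of translation vectors whose `j`-th coordinates are given by the permutation
`σ j` of `0, …, n - 1`. -/
def permFamily {d n : ℕ} (σ : Fin d → Equiv.Perm (Fin n)) : Fin n → Euc d :=
  fun k => WithLp.toLp 2 fun j => ((σ j k : ℕ) : ℝ)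

@[simp]
lemma permFamily_apply {n : ℕ} (σ : Fin d → Equiv.Perm (Fin n)) (k : Fin n) (j : Fin d) :
    permFamily σ k j = ((σ j k : ℕ) : ℝ) := rfl

lemma CubeWNS.exists_volume_le_permFamily {n : ℕ} (hn : 1 ≤ n) {p : Fin n → Euc d}
    (hp : CubeWNS p) :
    ∃ σ : Fin d → Equiv.Perm (Fin n), volume (cubeHull p) ≤ volume (cubeHull (permFamily σ)) := by
  suffices h : ∀ s : Finset (Fin d), ∃ σ : Fin d → Equiv.Perm (Fin n), ∃ q : Fin n → Euc d,
      (∀ k, ∀ j ∈ s, q k j = permFamily σ k j) ∧ (∀ k, ∀ j ∉ s, q k j = p k j) ∧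
      volume (cubeHull p) ≤ volume (cubeHull q) by
    obtain ⟨σ, q, hq, -, hle⟩ := h Finset.univ
    have : q = permFamily σ := by
      ext k j
      exact hq k j (Finset.mem_univ j)
    exact ⟨σ, this ▸ hle⟩
  intro s
  induction s using Finset.induction_on with
  | empty => exact ⟨fun _ => 1, p, by simp, by simp, le_rfl⟩
  | insert j s hj ih =>
    obtain ⟨σ, q, hqs, hqp, hle⟩ := ih
    have hcoord : ∀ k, q k j = p k j := fun k => hqp k j hj
    obtain ⟨ρ, hρ⟩ := exists_perm_volume_le_setCoord hn j q (by
      simpa only [hcoord] using hp.monotone_sub_sort j)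
    refine ⟨Function.update σ j ρ, _, fun k i hi => ?_, fun k i hi => ?_, hle.trans hρ⟩
    · by_cases h : i = j
      · subst h
        simp
      · rw [setCoord_apply_of_ne h, hqs k i (Finset.mem_of_mem_insert_of_ne hi h)]
        simp [h]
    · rw [Finset.mem_insert, not_or] at hi
      rw [setCoord_apply_of_ne hi.1, hqp k i hi.2]

lemma cubeHull_permFamily_subset {n : ℕ} (σ : Fin d → Equiv.Perm (Fin n)) :
    cubeHull (permFamily σ) ⊆ {x : Euc d | ∀ j, x j ∈ Set.Icc (0 : ℝ) n} := by
  refine cubeHull_subset (fun x hx y hy a b ha hb hab i =>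
    convex_Icc (0 : ℝ) n (hx i) (hy i) ha hb hab) fun k c hc j => ?_
  have h : ((σ j k : ℕ) : ℝ) + 1 ≤ n := by exact_mod_cast (σ j k).isLt
  have h0 : (0 : ℝ) ≤ ((σ j k : ℕ) : ℝ) := Nat.cast_nonneg _
  have hcj := hc j
  simp only [PiLp.add_apply, permFamily_apply]
  exact ⟨by linarith [hcj.1], by linarith [hcj.2]⟩

/-- The cubes of a permutation family project onto all of `[0, n]` on every axis. -/
lemma exists_mem_permFamily_cube {n : ℕ} (hn : 1 ≤ n) (σ : Fin d → Equiv.Perm (Fin n)) (j : Fin d)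
    {c : ℝ} (hc : c ∈ Set.Icc (0 : ℝ) n) :
    ∃ k, ∃ y ∈ ({permFamily σ k} + unitCube d : Set (Euc d)), y j = c := by
  obtain ⟨m, hm, hmc, hcm⟩ : ∃ m < n, (m : ℝ) ≤ c ∧ c ≤ m + 1 := by
    rcases hc.2.lt_or_eq with h | h
    · exact ⟨⌊c⌋₊, (Nat.floor_lt hc.1).2 h, Nat.floor_le hc.1, (Nat.lt_floor_add_one c).le⟩
    · refine ⟨n - 1, by omega, ?_, ?_⟩ <;> rw [h, Nat.cast_sub hn] <;> simp
  refine ⟨(σ j).symm ⟨m, hm⟩, _, add_mem_add rfl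
    (show EuclideanSpace.single j (c - m) ∈ unitCube d from fun i => ?_), by simp⟩
  by_cases h : i = j
  · subst h
    simp only [PiLp.single_apply, if_true]
    exact ⟨by linarith, by linarith⟩
  · simp [h]

lemma cubeWNS_permFamily {n : ℕ} (hn : 1 ≤ n) (σ : Fin d → Equiv.Perm (Fin n)) :
    CubeWNS (permFamily σ) := by
  rintro j c ⟨x, hxc, hx⟩
  have hxj : x j = c := hxc
  obtain ⟨k, y, hy, hyc⟩ := exists_mem_permFamily_cube hn σ j
    (hxj ▸ cubeHull_permFamily_subset σ hx j)
  exact ⟨k, y, hyc, hy⟩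

/-- existence of a volume-maximizing WNS-family of n translates
of the unit cube whose smallest axis-parallel box is a translate of `[0,n]^d`. -/
theorem stmt_12 (d n : ℕ) (hd : 2 ≤ d) (hn : 1 ≤ n) :
    ∃ p₀ : Fin n → Euc d, CubeWNS p₀ ∧
      (∃ a : Fin d → ℝ,
        (⋃ k, {p₀ k} + unitCube d) ⊆
          {x : Euc d | ∀ j, x j ∈ Set.Icc (a j) (a j + n)} ∧
        ∀ j : Fin d, (∃ y ∈ ⋃ k, {p₀ k} + unitCube d, y j = a j) ∧
                     (∃ y ∈ ⋃ k, {p₀ k} + unitCube d, y j = a j + n)) ∧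
      ∀ p : Fin n → Euc d, CubeWNS p →
        volume (convexHull ℝ (⋃ k, {p k} + unitCube d)) ≤
          volume (convexHull ℝ (⋃ k, {p₀ k} + unitCube d)) := by
  obtain ⟨σ, hσ⟩ := Finite.exists_max fun σ : Fin d → Equiv.Perm (Fin n) =>
    volume (cubeHull (permFamily σ))
  refine ⟨permFamily σ, cubeWNS_permFamily hn σ, ⟨0, ?_, fun j => ⟨?_, ?_⟩⟩, fun p hp => ?_⟩
  · simpa using (subset_convexHull ℝ _).trans (cubeHull_permFamily_subset σ)
  · obtain ⟨k, y, hy, hyj⟩ := exists_mem_permFamily_cube hn σ j (c := 0) (by simp)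
    exact ⟨y, mem_iUnion.2 ⟨k, hy⟩, hyj⟩
  · obtain ⟨k, y, hy, hyj⟩ := exists_mem_permFamily_cube hn σ j (c := n) (by simp)
    exact ⟨y, mem_iUnion.2 ⟨k, hy⟩, by simpa using hyj⟩
  · obtain ⟨ρ, hρ⟩ := hp.exists_volume_le_permFamily hn
    exact hρ.trans (hσ ρ)

end
end

section
/- Let n ≥ 4 and let ℱ = {pₖ + C₂ : k = 1, …, n} be a weakly non-separable family of n translates of the unit square C₂ = [0,1]² in ℝ². Then the area (two-dimensional Lebesgue measure) of conv(⋃ℱ) is at most n² − 2n + 4. -/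
open Set Metric Pointwise MeasureTheory

noncomputable section

variable {d : ℕ}

/-- The open triangle with vertices `(0, 0)`, `(0, a)` and `(q, k * q)`. -/
def openTriangle (a q k : ℝ) : Set (ℝ × ℝ) :=
  regionBetween (fun u => k * u) (fun u => k * u + a * (1 - u / q)) (Ioo 0 q)

lemma measurableSet_openTriangle (a q k : ℝ) : MeasurableSet (openTriangle a q k) :=
  measurableSet_regionBetween (by fun_prop) (by fun_prop) measurableSet_Ioo

lemma volume_openTriangle {a q : ℝ} (ha : 0 ≤ a) (hq : 0 < q) (k : ℝ) :
    volume (openTriangle a q k) = ENNReal.ofReal (a * q / 2) := by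
  have hf : IntegrableOn (fun u : ℝ => k * u) (Ioo 0 q) :=
    (Continuous.integrableOn_Icc (by fun_prop)).mono_set Ioo_subset_Icc_self
  have hg : IntegrableOn (fun u : ℝ => k * u + a * (1 - u / q)) (Ioo 0 q) :=
    (Continuous.integrableOn_Icc (by fun_prop)).mono_set Ioo_subset_Icc_self
  have hle : ∀ u ∈ Ioo 0 q, k * u ≤ k * u + a * (1 - u / q) := fun u hu =>
    le_add_of_nonneg_right (mul_nonneg ha (sub_nonneg.2 ((div_le_one hq).2 hu.2.le)))
  rw [openTriangle, Measure.volume_eq_prod,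
    volume_regionBetween_eq_integral hf hg measurableSet_Ioo hle,
    ← integral_Ioc_eq_integral_Ioo, ← intervalIntegral.integral_of_le hq.le]
  congr 1
  have hfun : ((fun u : ℝ => k * u + a * (1 - u / q)) - fun u => k * u) =
      fun u => a - (a / q) * u := by
    ext u
    simp only [Pi.sub_apply]
    ring
  rw [hfun, intervalIntegral.integral_sub (by simp)
      (Continuous.intervalIntegrable (by fun_prop) _ _),
    intervalIntegral.integral_const, intervalIntegral.integral_const_mul, integral_id]
  field_simp
  simp
  ring

lemma mem_openTriangle {a q k : ℝ} {z : ℝ × ℝ} : z ∈ openTriangle a q k ↔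
    (0 < z.1 ∧ z.1 < q) ∧ k * z.1 < z.2 ∧ z.2 < k * z.1 + a * (1 - z.1 / q) :=
  Iff.rfl

/-- For finitely many points in the closed positive quadrant touching both axes and spaced by at
least `e` horizontally and `f` vertically, a region near the origin that is strictly separated
from the points by lines of nonpositive slope has area at least `(e * y L + f * x B - 1) / 2`,
when `L` and `B` are the points nearest to the origin on the two axes. -/
lemma exists_corner_region_of_nearest {ι : Type*} [Finite ι] {x y : ι → ℝ} {L B : ι}
    (hx : ∀ i, 0 ≤ x i) (hy : ∀ i, 0 ≤ y i) (hL : x L = 0) (hB : y B = 0)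
    (hL_le : ∀ i, x i = 0 → y L ≤ y i) (hB_le : ∀ i, y i = 0 → x B ≤ x i)
    {e f : ℝ} (he0 : 0 ≤ e) (he1 : e ≤ 1) (hf1 : f ≤ 1)
    (hex : ∀ i j, i ≠ j → e ≤ |x i - x j|) (hfy : ∀ i j, i ≠ j → f ≤ |y i - y j|) :
    ∃ M : Set (ℝ × ℝ), MeasurableSet M ∧
      (∀ z ∈ M, 0 ≤ z.1 ∧ 0 ≤ z.2 ∧
        ∃ p q : ℝ, 0 ≤ p ∧ 0 ≤ q ∧ ∀ i, p * z.1 + q * z.2 < p * x i + q * y i) ∧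
      ENNReal.ofReal ((e * y L + f * x B - 1) / 2) ≤ volume M := by
  rcases (hy L).eq_or_lt with ha | ha
  · have hb : x B = 0 := le_antisymm (hL ▸ hB_le L ha.symm) (hx B)
    exact ⟨∅, .empty, by simp, by rw [← ha, hb]; norm_num⟩
  rcases (hx B).eq_or_lt with hb | hb
  · exact absurd (hB ▸ hL_le B hb.symm) ha.not_ge
  set a := y L with ha_def
  set b := x B with hb_def
  by_cases hline : ∀ i, a * b ≤ a * x i + b * y i
  · refine ⟨openTriangle a b 0, measurableSet_openTriangle _ _ _, ?_, ?_⟩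
    · rintro z hz
      rw [mem_openTriangle] at hz
      obtain ⟨⟨h1, h2⟩, h3, h4⟩ := hz
      refine ⟨h1.le, by linarith, a, b, ha.le, hb.le, fun i => lt_of_lt_of_le ?_ (hline i)⟩
      have : b * z.2 < b * (a * (1 - z.1 / b)) := by
        apply mul_lt_mul_of_pos_left _ hb
        linarith
      have h5 : b * (a * (1 - z.1 / b)) = a * b - a * z.1 := by field_simp
      linarith
    · rw [volume_openTriangle ha.le hb]
      apply ENNReal.ofReal_le_ofReal
      have hne : L ≠ B := by
        rintro rfl
        linarith
      have h1 := hex L B hne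
      have h2 := hfy L B hne
      rw [hL, zero_sub, abs_neg, abs_of_pos hb] at h1
      rw [hB, sub_zero, abs_of_pos ha] at h2
      nlinarith [mul_nonneg (sub_nonneg.2 h1) (sub_nonneg.2 h2)]
  push Not at hline
  obtain ⟨o, ho⟩ := hline
  have hxo : 0 < x o := by
    rcases (hx o).eq_or_lt with h | h
    · nlinarith [hL_le o h.symm]
    · exact h
  have hyo : 0 < y o := by
    rcases (hy o).eq_or_lt with h | h
    · nlinarith [hB_le o h.symm]
    · exact h
  obtain ⟨j, hj, hjmin⟩ := Set.exists_min_image {i | 0 < x i} (fun i => (y i - a) / x i)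
    (Set.toFinite _) ⟨o, hxo⟩
  obtain ⟨k, hk, hkmin⟩ := Set.exists_min_image {i | 0 < y i} (fun i => (x i - b) / y i)
    (Set.toFinite _) ⟨o, hyo⟩
  simp only [mem_ofPred_eq] at hj hjmin hk hkmin
  have hjle : ∀ i, a * x j ≤ (a - y j) * x i + x j * y i := by
    intro i
    rcases (hx i).eq_or_lt with h | h
    · have := hL_le i h.symm
      rw [← h]
      nlinarith
    · have := hjmin i h
      rw [div_le_div_iff₀ hj h] at this
      nlinarith
  have hkle : ∀ i, b * y k ≤ (b - x k) * y i + y k * x i := by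
    intro i
    rcases (hy i).eq_or_lt with h | h
    · have := hB_le i h.symm
      rw [← h]
      nlinarith
    · have := hkmin i h
      rw [div_le_div_iff₀ hk h] at this
      nlinarith
  have hyja : y j ≤ a := by
    by_contra! h
    have h1 := hjle o
    have h2 : y o < a := by nlinarith
    nlinarith
  have hxkb : x k ≤ b := by
    by_contra! h
    have h1 := hkle o
    have h2 : x o < b := by nlinarith
    nlinarith
  have hsteep : y k * x j ≤ y j * x k := by
    by_contra! hlt
    have h1 := hjle k
    have h2 := hkle j
    have h3 : b * y k < (b - x k) * a := by
      have h4 := hkle o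
      have h5 : 0 < y o * ((b - x k) * a - y k * b) := by nlinarith
      have := pos_of_mul_pos_right h5 hyo.le
      linarith
    have hD : 0 < y k * x j - x k * y j := by linarith
    have h6 := mul_lt_mul_of_pos_left h3 hD
    have h7 := mul_le_mul_of_nonneg_left h2 (mul_nonneg ha.le (hx k))
    have h8 := mul_le_mul_of_nonneg_right
      (show a * x j ≤ (y k * x j - x k * y j) + a * x k by linarith)
      (mul_nonneg hb.le hk.le)
    nlinarith
  have hej : e ≤ x j := by
    have := hex j L (by rintro rfl; linarith)
    rwa [hL, sub_zero, abs_of_pos hj] at this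
  have hfk : f ≤ y k := by
    have := hfy k B (by rintro rfl; linarith)
    rwa [hB, sub_zero, abs_of_pos hk] at this
  have hbelow : ∀ {c q r : ℝ} {z : ℝ × ℝ}, 0 < q → z ∈ openTriangle c q (r / q) →
      (c - r) * z.1 + q * z.2 < c * q ∧ r * z.1 < q * z.2 := by
    intro c q r z hq hz
    rw [mem_openTriangle] at hz
    obtain ⟨-, h3, h4⟩ := hz
    have h5 := mul_lt_mul_of_pos_left h3 hq
    have h6 := mul_lt_mul_of_pos_left h4 hq
    have h7 : q * (r / q * z.1) = r * z.1 := by field_simp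
    have h8 : q * (r / q * z.1 + c * (1 - z.1 / q)) = r * z.1 + c * (q - z.1) := by field_simp
    constructor <;> nlinarith
  have hquad : ∀ {c q r : ℝ} {z : ℝ × ℝ}, 0 < q → 0 ≤ r → z ∈ openTriangle c q (r / q) →
      0 ≤ z.1 ∧ 0 ≤ z.2 := by
    intro c q r z hq hr hz
    rw [mem_openTriangle] at hz
    exact ⟨hz.1.1.le, (mul_nonneg (div_nonneg hr hq.le) hz.1.1.le).trans hz.2.1.le⟩
  have hmeas := measurableSet_openTriangle b (y k) (x k / y k)
  refine ⟨openTriangle a (x j) (y j / x j) ∪ Prod.swap ⁻¹' openTriangle b (y k) (x k / y k),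
    (measurableSet_openTriangle _ _ _).union (measurable_swap hmeas), ?_, ?_⟩
  · rintro z (hz | hz)
    · obtain ⟨h1, h2⟩ := hquad hj (hy j) hz
      exact ⟨h1, h2, a - y j, x j, by linarith, hj.le,
        fun i => (hbelow hj hz).1.trans_le (hjle i)⟩
    · obtain ⟨h1, h2⟩ := hquad hk (hx k) hz
      refine ⟨h2, h1, y k, b - x k, hk.le, by linarith, fun i => ?_⟩
      have := (hbelow hk hz).1.trans_le (hkle i)
      simp only [Prod.fst_swap, Prod.snd_swap] at this
      linarith
  · have hswap : MeasurePreserving (Prod.swap : ℝ × ℝ → ℝ × ℝ) := Measure.measurePreserving_swap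
    rw [measure_union _ (measurable_swap hmeas), volume_openTriangle ha.le hj,
      hswap.measure_preimage hmeas.nullMeasurableSet, volume_openTriangle hb.le hk,
      ← ENNReal.ofReal_add (by positivity) (by positivity)]
    · apply ENNReal.ofReal_le_ofReal
      nlinarith
    · rw [Set.disjoint_left]
      intro z hz hz'
      have h1 := (hbelow hj hz).2
      have h2 := (hbelow hk hz').2
      have h3 := (mem_openTriangle.1 hz).1.1
      simp only [Prod.fst_swap, Prod.snd_swap] at h2
      have h4 : 0 < x k := by
        have := mul_pos hk hj
        exact pos_of_mul_pos_right (this.trans_le hsteep) (hy j)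
      nlinarith [mul_lt_mul_of_pos_left h1 h4, mul_lt_mul_of_pos_left h2 hj]

lemma exists_corner_region {ι : Type*} [Finite ι] {x y : ι → ℝ} {L B : ι}
    (hx : ∀ i, 0 ≤ x i) (hy : ∀ i, 0 ≤ y i) (hL : x L = 0) (hB : y B = 0)
    {e f : ℝ} (he0 : 0 ≤ e) (he1 : e ≤ 1) (hf0 : 0 ≤ f) (hf1 : f ≤ 1)
    (hex : ∀ i j, i ≠ j → e ≤ |x i - x j|) (hfy : ∀ i j, i ≠ j → f ≤ |y i - y j|) :
    ∃ M : Set (ℝ × ℝ), MeasurableSet M ∧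
      (∀ z ∈ M, 0 ≤ z.1 ∧ 0 ≤ z.2 ∧
        ∃ p q : ℝ, 0 ≤ p ∧ 0 ≤ q ∧ ∀ i, p * z.1 + q * z.2 < p * x i + q * y i) ∧
      ENNReal.ofReal ((e * y L + f * x B - 1) / 2) ≤ volume M := by
  obtain ⟨L', hL', hLmin⟩ := Set.exists_min_image {i | x i = 0} y (Set.toFinite _) ⟨L, hL⟩
  obtain ⟨B', hB', hBmin⟩ := Set.exists_min_image {i | y i = 0} x (Set.toFinite _) ⟨B, hB⟩
  simp only [mem_ofPred_eq] at hL' hB'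
  have h1 : e * y L = e * y L' := by
    rcases eq_or_ne L L' with rfl | hne
    · rfl
    · have := hex _ _ hne
      rw [hL, hL', sub_zero, abs_zero] at this
      rw [le_antisymm this he0, zero_mul, zero_mul]
  have h2 : f * x B = f * x B' := by
    rcases eq_or_ne B B' with rfl | hne
    · rfl
    · have := hfy _ _ hne
      rw [hB, hB', sub_zero, abs_zero] at this
      rw [le_antisymm this hf0, zero_mul, zero_mul]
  rw [h1, h2]
  exact exists_corner_region_of_nearest hx hy hL' hB' hLmin hBmin he0 he1 hf1 hex hfy

lemma measurePreserving_mul_sub {s : ℝ} (hs : s = 1 ∨ s = -1) (c : ℝ) :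
    MeasurePreserving (fun u : ℝ => s * u - c) := by
  rcases hs with rfl | rfl
  · simpa using measurePreserving_sub_right (volume : Measure ℝ) c
  · have := (measurePreserving_sub_right (volume : Measure ℝ) c).comp
      (Measure.measurePreserving_neg (volume : Measure ℝ))
    simpa [Function.comp_def] using this

/-- The convex hull of the unit squares with lower left corners `(x i, y i)`. -/
def squareHull {ι : Type*} (x y : ι → ℝ) : Set (ℝ × ℝ) :=
  convexHull ℝ (⋃ i, Icc (x i) (x i + 1) ×ˢ Icc (y i) (y i + 1))

lemma mem_squareHull {ι : Type*} {x y : ι → ℝ} (i : ι) {z : ℝ × ℝ}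
    (h1 : z.1 ∈ Icc (x i) (x i + 1)) (h2 : z.2 ∈ Icc (y i) (y i + 1)) : z ∈ squareHull x y :=
  subset_convexHull ℝ _ (mem_iUnion.2 ⟨i, h1, h2⟩)

/-- The part of the bounding box near one of its corners, selected by the signs `s` and `t`, that
is missed by the hull of unit squares with spaced coordinates. -/
lemma exists_missed_region {ι : Type*} [Finite ι] {x y : ι → ℝ} {s t : ℝ}
    (hs : s = 1 ∨ s = -1) (ht : t = 1 ∨ t = -1) {L B : ι}
    (hL : ∀ i, s * x L ≤ s * x i) (hB : ∀ i, t * y B ≤ t * y i)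
    {e f : ℝ} (he0 : 0 ≤ e) (he1 : e ≤ 1) (hf0 : 0 ≤ f) (hf1 : f ≤ 1)
    (hex : ∀ i j, i ≠ j → e ≤ |x i - x j|) (hfy : ∀ i j, i ≠ j → f ≤ |y i - y j|) :
    ∃ M : Set (ℝ × ℝ), MeasurableSet M ∧
      (∀ z ∈ M, s * z.1 ∈ Icc (s * x L + (s - 1) / 2) (s * x B + (s - 1) / 2) ∧
        t * z.2 ∈ Icc (t * y B + (t - 1) / 2) (t * y L + (t - 1) / 2) ∧
        ∀ k ∈ squareHull x y, ¬ (s * k.1 ≤ s * z.1 ∧ t * k.2 ≤ t * z.2)) ∧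
      ENNReal.ofReal ((e * (t * y L - t * y B) + f * (s * x B - s * x L) - 1) / 2) ≤
        volume M := by
  have habs : ∀ {r : ℝ}, r = 1 ∨ r = -1 → ∀ u v w : ℝ, |(r * u - w) - (r * v - w)| = |u - v| := by
    rintro r (rfl | rfl) u v w
    · congr 1
      ring
    · rw [← abs_neg]
      congr 1
      ring
  obtain ⟨M, hM, hsep, hvol⟩ := exists_corner_region (x := fun i => s * x i - s * x L)
    (y := fun i => t * y i - t * y B) (L := L) (B := B) (fun i => sub_nonneg.2 (hL i))
    (fun i => sub_nonneg.2 (hB i)) (sub_self _) (sub_self _) he0 he1 hf0 hf1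
    (fun i j hij => (habs hs _ _ _).symm ▸ hex i j hij)
    (fun i j hij => (habs ht _ _ _).symm ▸ hfy i j hij)
  have hΦ : MeasurePreserving (fun z : ℝ × ℝ =>
      (s * z.1 - (s * x L + (s - 1) / 2), t * z.2 - (t * y B + (t - 1) / 2))) :=
    (measurePreserving_mul_sub hs _).prod (measurePreserving_mul_sub ht _)
  refine ⟨_, hΦ.measurable hM, ?_, (hΦ.measure_preimage hM.nullMeasurableSet).symm ▸ hvol⟩
  intro z hz
  obtain ⟨h1, h2, p, q, hp, hq, hlt⟩ := hsep _ hz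
  simp only at h1 h2 hlt
  have hcorner : ∀ k ∈ squareHull x y, ¬ (s * k.1 ≤ s * z.1 ∧ t * k.2 ≤ t * z.2) := by
    have hlow : ∀ {r : ℝ}, r = 1 ∨ r = -1 → ∀ {u v : ℝ}, v ∈ Icc u (u + 1) →
        r * u + (r - 1) / 2 ≤ r * v := by
      rintro r (rfl | rfl) u v ⟨h, h'⟩ <;> linarith
    have hsub : squareHull x y ⊆ {k | p * (s * z.1) + q * (t * z.2) <
        ((p * s) • LinearMap.fst ℝ ℝ ℝ + (q * t) • LinearMap.snd ℝ ℝ ℝ) k} := by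
      refine convexHull_min (iUnion_subset fun i k hk => ?_)
        (convex_halfSpace_gt (LinearMap.isLinear _) _)
      have h3 := mul_le_mul_of_nonneg_left (hlow hs hk.1) hp
      have h4 := mul_le_mul_of_nonneg_left (hlow ht hk.2) hq
      have h5 := hlt i
      simp only [mem_ofPred_eq, LinearMap.add_apply, LinearMap.smul_apply, LinearMap.fst_apply,
        LinearMap.snd_apply, smul_eq_mul]
      linarith
    rintro k hk ⟨h3, h4⟩
    have h5 := hsub hk
    simp only [mem_ofPred_eq, LinearMap.add_apply, LinearMap.smul_apply, LinearMap.fst_apply,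
      LinearMap.snd_apply, smul_eq_mul] at h5
    have := mul_le_mul_of_nonneg_left h3 hp
    have := mul_le_mul_of_nonneg_left h4 hq
    linarith
  have hmem : ∀ i, (x i + (1 - s) / 2, y i + (1 - t) / 2) ∈ squareHull x y := by
    intro i
    apply mem_squareHull i <;> rcases hs with rfl | rfl <;> rcases ht with rfl | rfl <;>
      constructor <;> simp
  have hmul : ∀ {r : ℝ}, r = 1 ∨ r = -1 → ∀ u, r * (u + (1 - r) / 2) = r * u + (r - 1) / 2 := by
    rintro r (rfl | rfl) u <;> ring
  refine ⟨⟨by linarith, ?_⟩, ⟨by linarith, ?_⟩, hcorner⟩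
  · by_contra! h
    exact hcorner _ (hmem B) ⟨by rw [hmul hs]; exact h.le, by rw [hmul ht]; linarith⟩
  · by_contra! h
    exact hcorner _ (hmem L) ⟨by rw [hmul hs]; linarith, by rw [hmul ht]; exact h.le⟩

/-- An area bound for the hull of unit squares with spaced coordinates. -/
lemma volume_squareHull_le {ι : Type*} [Finite ι] {x y : ι → ℝ} {L R B T : ι}
    (hL : ∀ i, x L ≤ x i) (hR : ∀ i, x i ≤ x R) (hB : ∀ i, y B ≤ y i) (hT : ∀ i, y i ≤ y T)
    {e f : ℝ} (he0 : 0 ≤ e) (he1 : e ≤ 1) (hf0 : 0 ≤ f) (hf1 : f ≤ 1)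
    (hex : ∀ i j, i ≠ j → e ≤ |x i - x j|) (hfy : ∀ i j, i ≠ j → f ≤ |y i - y j|) :
    volume (squareHull x y) ≤ ENNReal.ofReal ((x R - x L + 1) * (y T - y B + 1) -
      (e * (y T - y B) + f * (x R - x L) - 2)) := by
  have hone : (1 : ℝ) = 1 ∨ (1 : ℝ) = -1 := .inl rfl
  have hneg : (-1 : ℝ) = 1 ∨ (-1 : ℝ) = -1 := .inr rfl
  obtain ⟨M₁, hm₁, hM₁, hv₁⟩ := exists_missed_region hone hone (L := L) (B := B)
    (by simpa using hL) (by simpa using hB) he0 he1 hf0 hf1 hex hfy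
  obtain ⟨M₂, hm₂, hM₂, hv₂⟩ := exists_missed_region hneg hone (L := R) (B := B)
    (by simpa using hR) (by simpa using hB) he0 he1 hf0 hf1 hex hfy
  obtain ⟨M₃, hm₃, hM₃, hv₃⟩ := exists_missed_region hone hneg (L := L) (B := T)
    (by simpa using hL) (by simpa using hT) he0 he1 hf0 hf1 hex hfy
  obtain ⟨M₄, hm₄, hM₄, hv₄⟩ := exists_missed_region hneg hneg (L := R) (B := T)
    (by simpa using hR) (by simpa using hT) he0 he1 hf0 hf1 hex hfy
  set K := squareHull x y with hK
  have hconv : Convex ℝ K := convex_convexHull ℝ _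
  set box := Icc (x L) (x R + 1) ×ˢ Icc (y B) (y T + 1) with hbox
  have hKbox : K ⊆ box := by
    refine convexHull_min (iUnion_subset fun i => ?_) ((convex_Icc _ _).prod (convex_Icc _ _))
    exact prod_mono (Icc_subset_Icc (hL i) (by linarith [hR i]))
      (Icc_subset_Icc (hB i) (by linarith [hT i]))
  have hbox₁ : M₁ ⊆ box := by
    intro z hz
    obtain ⟨⟨h1, h2⟩, ⟨h3, h4⟩, -⟩ := hM₁ z hz
    exact ⟨⟨by linarith, by linarith [hR B]⟩, ⟨by linarith, by linarith [hT L]⟩⟩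
  have hbox₂ : M₂ ⊆ box := by
    intro z hz
    obtain ⟨⟨h1, h2⟩, ⟨h3, h4⟩, -⟩ := hM₂ z hz
    exact ⟨⟨by linarith [hL B], by linarith⟩, ⟨by linarith, by linarith [hT R]⟩⟩
  have hbox₃ : M₃ ⊆ box := by
    intro z hz
    obtain ⟨⟨h1, h2⟩, ⟨h3, h4⟩, -⟩ := hM₃ z hz
    exact ⟨⟨by linarith, by linarith [hR T]⟩, ⟨by linarith [hB L], by linarith⟩⟩
  have hbox₄ : M₄ ⊆ box := by
    intro z hz
    obtain ⟨⟨h1, h2⟩, ⟨h3, h4⟩, -⟩ := hM₄ z hz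
    exact ⟨⟨by linarith [hL T], by linarith⟩, ⟨by linarith [hB R], by linarith⟩⟩
  have hvert : ∀ z ∈ box, ∃ k ∈ K, k.1 = z.1 := by
    intro z hz
    exact (hconv.linear_image (LinearMap.fst ℝ ℝ ℝ)).ordConnected.out
      ⟨(x L, y L), mem_squareHull L (by simp) (by simp), rfl⟩
      ⟨(x R + 1, y R), mem_squareHull R (by simp) (by simp), rfl⟩ hz.1
  have hhoriz : ∀ z ∈ box, ∃ k ∈ K, k.2 = z.2 := by
    intro z hz
    exact (hconv.linear_image (LinearMap.snd ℝ ℝ ℝ)).ordConnected.out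
      ⟨(x B, y B), mem_squareHull B (by simp) (by simp), rfl⟩
      ⟨(x T, y T + 1), mem_squareHull T (by simp) (by simp), rfl⟩ hz.2
  have hsplit_x : ∀ z ∈ box, ∃ k ∈ K, k.2 = z.2 ∧ (k.1 ≤ z.1 ∨ z.1 ≤ k.1) := by
    intro z hz
    obtain ⟨k, hk, h⟩ := hhoriz z hz
    exact ⟨k, hk, h, le_total _ _⟩
  have hsplit_y : ∀ z ∈ box, ∃ k ∈ K, k.1 = z.1 ∧ (k.2 ≤ z.2 ∨ z.2 ≤ k.2) := by
    intro z hz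
    obtain ⟨k, hk, h⟩ := hvert z hz
    exact ⟨k, hk, h, le_total _ _⟩
  have hd₁ : Disjoint K M₁ :=
    Set.disjoint_left.2 fun z hz hz' => (hM₁ z hz').2.2 z hz ⟨le_rfl, le_rfl⟩
  have hd₂ : Disjoint (K ∪ M₁) M₂ := by
    refine Set.disjoint_union_left.2 ⟨Set.disjoint_left.2 fun z hz hz' =>
      (hM₂ z hz').2.2 z hz ⟨le_rfl, le_rfl⟩, Set.disjoint_left.2 fun z hz hz' => ?_⟩
    obtain ⟨k, hk, h, h' | h'⟩ := hsplit_x z (hbox₁ hz)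
    · exact (hM₁ z hz).2.2 k hk ⟨by linarith, by linarith⟩
    · exact (hM₂ z hz').2.2 k hk ⟨by linarith, by linarith⟩
  have hd₃ : Disjoint (K ∪ M₁ ∪ M₂) M₃ := by
    refine Set.disjoint_union_left.2 ⟨Set.disjoint_union_left.2
      ⟨Set.disjoint_left.2 fun z hz hz' => (hM₃ z hz').2.2 z hz ⟨le_rfl, le_rfl⟩,
        Set.disjoint_left.2 fun z hz hz' => ?_⟩, Set.disjoint_left.2 fun z hz hz' => ?_⟩
    · obtain ⟨k, hk, h, h' | h'⟩ := hsplit_y z (hbox₁ hz)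
      · exact (hM₁ z hz).2.2 k hk ⟨by linarith, by linarith⟩
      · exact (hM₃ z hz').2.2 k hk ⟨by linarith, by linarith⟩
    · obtain ⟨k, hk, h, h' | h'⟩ := hsplit_y z (hbox₂ hz)
      · exact (hM₂ z hz).2.2 k hk ⟨by linarith, by linarith⟩
      · exact (hM₃ z hz').2.2 k hk ⟨by linarith, by linarith⟩
  have hd₄ : Disjoint (K ∪ M₁ ∪ M₂ ∪ M₃) M₄ := by
    refine Set.disjoint_union_left.2 ⟨Set.disjoint_union_left.2 ⟨Set.disjoint_union_left.2
      ⟨Set.disjoint_left.2 fun z hz hz' => (hM₄ z hz').2.2 z hz ⟨le_rfl, le_rfl⟩,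
        Set.disjoint_left.2 fun z hz hz' => ?_⟩, Set.disjoint_left.2 fun z hz hz' => ?_⟩,
        Set.disjoint_left.2 fun z hz hz' => ?_⟩
    · obtain ⟨k, hk, h, h' | h'⟩ := hsplit_y z (hbox₁ hz)
      · exact (hM₁ z hz).2.2 k hk ⟨by linarith, by linarith⟩
      · exact (hM₄ z hz').2.2 k hk ⟨by linarith, by linarith⟩
    · obtain ⟨k, hk, h, h' | h'⟩ := hsplit_y z (hbox₂ hz)
      · exact (hM₂ z hz).2.2 k hk ⟨by linarith, by linarith⟩
      · exact (hM₄ z hz').2.2 k hk ⟨by linarith, by linarith⟩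
    · obtain ⟨k, hk, h, h' | h'⟩ := hsplit_x z (hbox₃ hz)
      · exact (hM₃ z hz).2.2 k hk ⟨by linarith, by linarith⟩
      · exact (hM₄ z hz').2.2 k hk ⟨by linarith, by linarith⟩
  have hw : 0 ≤ x R - x L := sub_nonneg.2 (hL R)
  have hh : 0 ≤ y T - y B := sub_nonneg.2 (hB T)
  have htotal : volume K + volume M₁ + volume M₂ + volume M₃ + volume M₄ ≤
      ENNReal.ofReal ((x R - x L + 1) * (y T - y B + 1)) := by
    rw [← measure_union hd₁ hm₁, ← measure_union hd₂ hm₂, ← measure_union hd₃ hm₃,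
      ← measure_union hd₄ hm₄]
    refine (measure_mono (union_subset (union_subset (union_subset (union_subset hKbox hbox₁)
      hbox₂) hbox₃) hbox₄)).trans_eq ?_
    rw [hbox, Measure.volume_eq_prod, Measure.prod_prod, Real.volume_Icc, Real.volume_Icc,
      ← ENNReal.ofReal_mul (by linarith)]
    congr 1
    ring
  have hmissed : ENNReal.ofReal (e * (y T - y B) + f * (x R - x L) - 2) ≤
      volume M₁ + volume M₂ + volume M₃ + volume M₄ := by
    refine le_trans ?_ (add_le_add (add_le_add (add_le_add hv₁ hv₂) hv₃) hv₄)
    refine le_trans (le_of_eq ?_) ((ENNReal.ofReal_add_le).trans (add_le_add_left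
      ((ENNReal.ofReal_add_le).trans (add_le_add_left ENNReal.ofReal_add_le _)) _))
    congr 1
    ring
  have hsum : volume K + ENNReal.ofReal (e * (y T - y B) + f * (x R - x L) - 2) ≤
      ENNReal.ofReal ((x R - x L + 1) * (y T - y B + 1)) := by
    refine (add_le_add_right hmissed _).trans ?_
    simpa only [add_assoc] using htotal
  rcases le_total 0 (e * (y T - y B) + f * (x R - x L) - 2) with hc | hc
  · rw [ENNReal.ofReal_sub _ hc]
    exact ENNReal.le_sub_of_add_le_right ENNReal.ofReal_ne_top hsum
  · exact (le_self_add.trans hsum).trans (ENNReal.ofReal_le_ofReal (by linarith))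

lemma volume_le_of_subset_unit_intervals {ι : Type*} {x : ι → ℝ} {S J : Set ℝ} {s : Finset ι}
    (h : S ⊆ (⋃ k ∈ s, Icc (x k) (x k + 1)) ∪ J) : volume S ≤ s.card + volume J := by
  refine (measure_mono h).trans ((measure_union_le _ _).trans (add_le_add_left ?_ _))
  refine (measure_biUnion_finset_le _ _).trans_eq ?_
  simp [Real.volume_Icc]

lemma length_le_card_of_unit_cover {n : ℕ} {x : Fin n → ℝ} {l r : ℝ}
    (h : ∀ c ∈ Icc l r, ∃ k, c ∈ Icc (x k) (x k + 1)) : r - l ≤ n := by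
  have hvol := volume_le_of_subset_unit_intervals (x := x) (S := Icc l r) (J := ∅)
    (s := Finset.univ) fun c hc => .inl (by simpa using h c hc)
  rw [Real.volume_Icc, measure_empty, add_zero, Finset.card_univ, Fintype.card_fin,
    ← ENNReal.ofReal_natCast] at hvol
  exact (ENNReal.ofReal_le_ofReal_iff n.cast_nonneg).1 hvol

lemma length_le_card_sub_one_add_of_unit_cover {n : ℕ} {x : Fin n → ℝ} {l r : ℝ}
    (h : ∀ c ∈ Icc l r, ∃ k, c ∈ Icc (x k) (x k + 1)) {i j : Fin n} (hij : i ≠ j) :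
    r - l ≤ n - 1 + |x i - x j| := by
  obtain ⟨J, hJ, hIJ⟩ : ∃ J : Set ℝ, volume J = ENNReal.ofReal |x i - x j| ∧
      Icc (x j) (x j + 1) ⊆ Icc (x i) (x i + 1) ∪ J := by
    rcases le_total (x i) (x j) with hle | hle
    · refine ⟨Icc (x i + 1) (x j + 1), ?_, fun c hc => ?_⟩
      · rw [Real.volume_Icc, abs_sub_comm, abs_of_nonneg (sub_nonneg.2 hle)]
        congr 1
        ring
      · rcases le_total c (x i + 1) with h' | h'
        · exact .inl ⟨hle.trans hc.1, h'⟩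
        · exact .inr ⟨h', hc.2⟩
    · refine ⟨Icc (x j) (x i), ?_, fun c hc => ?_⟩
      · rw [Real.volume_Icc, abs_of_nonneg (sub_nonneg.2 hle)]
      · rcases le_total c (x i) with h' | h'
        · exact .inr ⟨hc.1, h'⟩
        · exact .inl ⟨h', by linarith [hc.2]⟩
  have hvol := volume_le_of_subset_unit_intervals (x := x) (S := Icc l r) (J := J)
    (s := Finset.univ.erase j) fun c hc => by
      obtain ⟨k, hk⟩ := h c hc
      rcases eq_or_ne k j with rfl | hkj
      · rcases hIJ hk with hc' | hc'
        · exact .inl (mem_biUnion (x := i) (by simpa using hij) hc')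
        · exact .inr hc'
      · exact .inl (mem_biUnion (x := k) (by simpa using hkj) hk)
  have hn : 1 ≤ n := i.pos
  rw [Real.volume_Icc, hJ, Finset.card_erase_of_mem (Finset.mem_univ _), Finset.card_univ,
    Fintype.card_fin, ← ENNReal.ofReal_natCast,
    ← ENNReal.ofReal_add (Nat.cast_nonneg _) (abs_nonneg _), Nat.cast_sub hn, Nat.cast_one] at hvol
  refine (ENNReal.ofReal_le_ofReal_iff (add_nonneg ?_ (abs_nonneg _))).1 hvol
  exact sub_nonneg.2 (by exact_mod_cast hn)

/-- The area bound in coordinates: the bounding box is `w + 1` by `h + 1`, and `N + 1` is the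
number of squares. -/
lemma box_sub_corners_le {N w h e f : ℝ} (hw0 : 0 ≤ w) (hh0 : 0 ≤ h) (hw : w ≤ N) (hh : h ≤ N)
    (he : e = max 0 (w - N + 1)) (hf : f = max 0 (h - N + 1)) :
    (w + 1) * (h + 1) - (e * h + f * w - 2) ≤ N ^ 2 + 3 := by
  rcases le_total 0 (w - N + 1) with h1 | h1 <;> rcases le_total 0 (h - N + 1) with h2 | h2
  · rw [max_eq_right h1] at he
    rw [max_eq_right h2] at hf
    subst he hf
    nlinarith [mul_nonneg (sub_nonneg.2 hw) (sub_nonneg.2 hh)]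
  · rw [max_eq_right h1] at he
    rw [max_eq_left h2] at hf
    subst he hf
    nlinarith
  · rw [max_eq_left h1] at he
    rw [max_eq_right h2] at hf
    subst he hf
    nlinarith
  · rw [max_eq_left h1] at he
    rw [max_eq_left h2] at hf
    subst he hf
    nlinarith

lemma CubeWNS.exists_mem_Icc {d n : ℕ} {p : Fin n → Euc d} (h : CubeWNS p) (j : Fin d)
    {L R : Fin n} {c : ℝ} (hc : c ∈ Icc (p L j) (p R j + 1)) :
    ∃ k, c ∈ Icc (p k j) (p k j + 1) := by
  have hconv := (convex_convexHull ℝ (⋃ k, {p k} + unitCube d)).linear_image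
    (EuclideanSpace.proj (𝕜 := ℝ) j : Euc d →L[ℝ] ℝ).toLinearMap
  have hmem : ∀ (k : Fin n) (u : Euc d), u ∈ unitCube d →
      p k + u ∈ convexHull ℝ (⋃ k, {p k} + unitCube d) := fun k u hu =>
    subset_convexHull ℝ _ (mem_iUnion.2 ⟨k, add_mem_add rfl hu⟩)
  obtain ⟨z, hz, hzc⟩ := hconv.ordConnected.out
    ⟨p L + 0, hmem L 0 (fun i => by simp), by simp⟩
    ⟨p R + WithLp.toLp 2 (fun _ => 1), hmem R _ (fun i => by simp), by simp⟩ hc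
  obtain ⟨k, v, hv, hvk⟩ := h j c ⟨z, hzc, hz⟩
  obtain ⟨_, rfl, u, hu, rfl⟩ := hvk
  have hv' : p k j + u j = c := hv
  exact ⟨k, by linarith [(hu j).1], by linarith [(hu j).2]⟩

lemma volume_convexHull_cubes_le {n : ℕ} (p : Fin n → Euc 2) :
    volume (convexHull ℝ (⋃ k, {p k} + unitCube 2)) ≤
      volume (squareHull (fun k => p k 0) (fun k => p k 1)) := by
  let φ : Euc 2 ≃ᵐ ℝ × ℝ := (MeasurableEquiv.toLp 2 (Fin 2 → ℝ)).symm.trans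
    MeasurableEquiv.finTwoArrow
  have hφ : MeasurePreserving φ :=
    (volume_preserving_finTwoArrow ℝ).comp
      (EuclideanSpace.volume_preserving_symm_measurableEquiv_toLp (Fin 2))
  rw [← hφ.measure_preimage_equiv]
  refine measure_mono (convexHull_min (iUnion_subset fun k => ?_) ?_)
  · rintro _ ⟨_, rfl, u, hu, rfl⟩
    refine mem_squareHull k ?_ ?_
    · exact ⟨le_add_of_nonneg_right (hu 0).1, add_le_add_right (hu 0).2 _⟩
    · exact ⟨le_add_of_nonneg_right (hu 1).1, add_le_add_right (hu 1).2 _⟩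
  · exact (convex_convexHull ℝ _).linear_preimage
      ((EuclideanSpace.proj (𝕜 := ℝ) 0 : Euc 2 →L[ℝ] ℝ).toLinearMap.prod
        (EuclideanSpace.proj (𝕜 := ℝ) 1 : Euc 2 →L[ℝ] ℝ).toLinearMap)

/-- area bound for WNS-families of n translates of the unit
square. -/
theorem stmt_13 (n : ℕ) (hn : 4 ≤ n) (p : Fin n → Euc 2) (h : CubeWNS p) :
    volume (convexHull ℝ (⋃ k, {p k} + unitCube 2)) ≤
      ENNReal.ofReal ((n : ℝ) ^ 2 - 2 * n + 4) := by
  have : Nonempty (Fin n) := ⟨⟨0, by omega⟩⟩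
  obtain ⟨L, hL⟩ := Finite.exists_min fun k => p k 0
  obtain ⟨R, hR⟩ := Finite.exists_max fun k => p k 0
  obtain ⟨B, hB⟩ := Finite.exists_min fun k => p k 1
  obtain ⟨T, hT⟩ := Finite.exists_max fun k => p k 1
  have hx := fun c (hc : c ∈ Icc (p L 0) (p R 0 + 1)) => h.exists_mem_Icc 0 hc
  have hy := fun c (hc : c ∈ Icc (p B 1) (p T 1 + 1)) => h.exists_mem_Icc 1 hc
  have hw := length_le_card_of_unit_cover hx
  have hh := length_le_card_of_unit_cover hy
  refine (volume_convexHull_cubes_le p).trans ((volume_squareHull_le hL hR hB hT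
    (e := max 0 (p R 0 - p L 0 - (n - 1) + 1)) (f := max 0 (p T 1 - p B 1 - (n - 1) + 1))
    (le_max_left _ _) (max_le zero_le_one (by linarith))
    (le_max_left _ _) (max_le zero_le_one (by linarith)) ?_ ?_).trans
    (ENNReal.ofReal_le_ofReal ?_))
  · intro i j hij
    have := length_le_card_sub_one_add_of_unit_cover hx hij
    exact max_le (abs_nonneg _) (by linarith)
  · intro i j hij
    have := length_le_card_sub_one_add_of_unit_cover hy hij
    exact max_le (abs_nonneg _) (by linarith)
  · have := box_sub_corners_le (N := n - 1) (sub_nonneg.2 (hL R)) (sub_nonneg.2 (hB T))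
      (by linarith) (by linarith) rfl rfl
    linarith

end
end

section
/- Let d ≥ 3 and n ≥ 2, let P be a d-polytope in ℝ^d, and let 𝒫 = {xᵢ + τᵢP : xᵢ ∈ ℝ^d, τᵢ > 0, i = 1, …, n} be a weakly (d−2)-impassable family of positive homothets of P. Let Q = conv(⋃𝒫). Then every edge of Q is covered by ⋃𝒫: for every unit vector u ∈ ℝ^d, if the exposed face F(Q,u) = {x ∈ Q : ⟨x,u⟩ = sup_{y∈Q} ⟨y,u⟩} has affine dimension one (i.e., is a nondegenerate segment), then F(Q,u) ⊆ ⋃𝒫. -/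
open Set Metric Pointwise MeasureTheory

noncomputable section

variable {d : ℕ}

/-- The direction of an exposed face is orthogonal to its normal vector. -/
lemma vectorSpan_exposedFaceAt_le (K : Set (Euc d)) (u : Euc d) :
    vectorSpan ℝ (exposedFaceAt K u) ≤ (ℝ ∙ u)ᗮ := by
  rw [vectorSpan, Submodule.span_le]
  rintro _ ⟨a, ha, b, hb, rfl⟩
  have h : inner ℝ a u = inner ℝ b u := le_antisymm (hb.2 a ha.1) (ha.2 b hb.1)
  rw [SetLike.mem_coe, Submodule.mem_orthogonal_singleton_iff_inner_left]
  simp [inner_sub_left, h]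

/-- A point of a polytope at which a linear functional is maximal is a convex combination of
those generators at which the functional is maximal. -/
lemma mem_convexHull_filter_of_maximal {E : Type*} [AddCommGroup E] [Module ℝ E]
    (S : Finset E) (f : E →ₗ[ℝ] ℝ) {y : E}
    (hy : y ∈ convexHull ℝ (S : Set E)) (hmax : ∀ s ∈ S, f s ≤ f y) :
    y ∈ convexHull ℝ {s | s ∈ S ∧ f s = f y} := by
  obtain ⟨w, hw0, hw1, hwy⟩ := Finset.mem_convexHull'.1 hy
  have hsum : ∑ s ∈ S, w s * (f y - f s) = 0 := by
    have h : f y = ∑ s ∈ S, w s * f s := by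
      conv_lhs => rw [← hwy]
      simp
    simp only [mul_sub, Finset.sum_sub_distrib, ← Finset.sum_mul, hw1, ← h]
    ring
  have hzero := (Finset.sum_eq_zero_iff_of_nonneg fun s hs =>
    mul_nonneg (hw0 s hs) (sub_nonneg.2 (hmax s hs))).1 hsum
  have hsupp : ∀ s ∈ S, w s ≠ 0 → f s = f y := fun s hs hne => by
    have := (mul_eq_zero.1 (hzero s hs)).resolve_left hne
    linarith
  classical
  have key : y ∈ convexHull ℝ ((S.filter fun s => f s = f y : Finset E) : Set E) := by
    refine Finset.mem_convexHull'.2 ⟨w, fun s hs => hw0 s (Finset.mem_filter.1 hs).1, ?_, ?_⟩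
    · rw [Finset.sum_filter_of_ne hsupp, hw1]
    · rw [Finset.sum_filter_of_ne, hwy]
      exact fun s hs hne => hsupp s hs fun h0 => hne (by simp [h0])
  simpa using key

/-- Finitely many affine subspaces of codimension at least two, swept along a fixed direction,
do not cover a nonempty open set. -/
lemma exists_mem_interior_forall_add_smul_notMem (P : Set (Euc d)) (hP : (interior P).Nonempty)
    (S : Finset (Euc d)) (e : Euc d) :
    ∃ q ∈ interior P, ∀ T : Set (Euc d), T ⊆ S →
      Module.finrank ℝ (vectorSpan ℝ T) + 1 < d →
      ∀ t : ℝ, q + t • e ∉ affineSpan ℝ T := by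
  let Z : Set (Euc d) → Set (Euc d) := fun T => {q | ∃ t : ℝ, q + t • e ∈ affineSpan ℝ T}
  let 𝒯 : Set (Set (Euc d)) :=
    {T | T ⊆ S ∧ Module.finrank ℝ (vectorSpan ℝ T) + 1 < d}
  have hfin : 𝒯.Finite := (S.finite_toSet.finite_subsets).subset fun T hT => hT.1
  have hnull : volume (⋃ T ∈ 𝒯, Z T) = 0 := by
    rw [measure_biUnion_null_iff hfin.countable]
    rintro T ⟨-, hT⟩
    rcases T.eq_empty_or_nonempty with rfl | ⟨a, ha⟩
    · have : Z ∅ = ∅ := by ext; simp [Z, AffineSubspace.notMem_bot]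
      simp [this]
    · let B := AffineSubspace.mk' a (vectorSpan ℝ T ⊔ ℝ ∙ e)
      have hB : B ≠ ⊤ := fun h => by
        have h1 : B.direction = ⊤ := by rw [h, AffineSubspace.direction_top]
        rw [AffineSubspace.direction_mk'] at h1
        have h2 := Submodule.finrank_add_le_finrank_add_finrank (vectorSpan ℝ T) (ℝ ∙ e)
        have h3 := finrank_span_le_card (R := ℝ) ({e} : Set (Euc d))
        simp only [Set.toFinset_singleton, Finset.card_singleton] at h3
        rw [h1, finrank_top, finrank_euclideanSpace_fin] at h2
        omega
      refine measure_mono_null ?_ (Measure.addHaar_affineSubspace volume B hB)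
      rintro q ⟨t, ht⟩
      rw [SetLike.mem_coe, AffineSubspace.mem_mk']
      have h1 : (q + t • e) -ᵥ a ∈ vectorSpan ℝ T := by
        rw [← direction_affineSpan]
        exact AffineSubspace.vsub_mem_direction ht (mem_affineSpan ℝ ha)
      have h2 : q -ᵥ a = ((q + t • e) -ᵥ a) + (-t) • e := by
        simp only [vsub_eq_sub, neg_smul]; abel
      rw [h2]
      exact Submodule.add_mem_sup h1
        (Submodule.smul_mem _ _ (Submodule.mem_span_singleton_self e))
  have hpos : 0 < volume (interior P) := isOpen_interior.measure_pos volume hP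
  obtain ⟨q, hq, hqZ⟩ : ∃ q ∈ interior P, q ∉ ⋃ T ∈ 𝒯, Z T := by
    by_contra! h
    exact hpos.ne' (measure_mono_null h hnull)
  refine ⟨q, hq, fun T hTS hT t ht => hqZ ?_⟩
  exact Set.mem_biUnion (show T ∈ 𝒯 from ⟨hTS, hT⟩) ⟨t, ht⟩

/-- From a point of a compact set, one leaves the set along any nonzero direction through a
point that is not interior. -/
lemma exists_add_smul_mem_notMem_interior {P : Set (Euc d)} (hP : IsCompact P) {q e : Euc d}
    (hq : q ∈ P) (he : e ≠ 0) : ∃ t : ℝ, q + t • e ∈ P ∧ q + t • e ∉ interior P := by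
  by_contra! h
  let g : ℝ → Euc d := fun t => q + t • e
  have hg : Continuous g := by fun_prop
  have hpre : g ⁻¹' P = g ⁻¹' interior P :=
    Set.Subset.antisymm (fun t ht => h t ht) (Set.preimage_mono interior_subset)
  have hclopen : IsClopen (g ⁻¹' P) :=
    ⟨hP.isClosed.preimage hg, hpre ▸ isOpen_interior.preimage hg⟩
  have huniv : g ⁻¹' P = univ := hclopen.eq_univ ⟨0, by simpa [g] using hq⟩
  obtain ⟨C, hC⟩ := hP.isBounded.exists_norm_le
  have he' : 0 < ‖e‖ := norm_pos_iff.2 he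
  have hmem : g ((C + ‖q‖ + 1) / ‖e‖) ∈ P := by
    have : (C + ‖q‖ + 1) / ‖e‖ ∈ g ⁻¹' P := huniv ▸ mem_univ _
    exact this
  have h1 := hC _ hmem
  have hC0 : 0 ≤ C := (norm_nonneg _).trans h1
  have h2 : ‖((C + ‖q‖ + 1) / ‖e‖) • e‖ = C + ‖q‖ + 1 := by
    rw [norm_smul, Real.norm_of_nonneg (by positivity), div_mul_cancel₀ _ he'.ne']
  have h3 := norm_sub_le (g ((C + ‖q‖ + 1) / ‖e‖)) q
  simp only [g, add_sub_cancel_left] at h3 h1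
  linarith

/-- For every direction, a polytope has a facet that is not parallel to it. -/
lemma exists_isFacetNormal_inner_ne_zero {P : Set (Euc d)} (hP : IsPolytope P) {e : Euc d}
    (he : e ≠ 0) : ∃ w, IsFacetNormal P w ∧ inner ℝ w e ≠ 0 := by
  obtain ⟨S, rfl, hint⟩ := hP
  set P := convexHull ℝ (S : Set (Euc d)) with hPdef
  have hconv : Convex ℝ P := convex_convexHull ℝ _
  obtain ⟨q, hq, hgen⟩ := exists_mem_interior_forall_add_smul_notMem P hint S e
  obtain ⟨t, htP, htint⟩ := exists_add_smul_mem_notMem_interior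
    (S.finite_toSet.isCompact_convexHull ℝ) (interior_subset hq) he
  set y := q + t • e with hy
  obtain ⟨f, hf⟩ := geometric_hahn_banach_open_point hconv.interior isOpen_interior htint
  have hfP : ∀ a ∈ P, f a ≤ f y := fun a ha => by
    have h1 : a ∈ closure (interior P) := by
      rw [hconv.closure_interior_eq_closure_of_nonempty_interior hint]
      exact subset_closure ha
    exact closure_minimal (t := {a | f a ≤ f y}) (fun b hb => (hf b hb).le)
      (isClosed_le f.continuous continuous_const) h1
  have hfe : f e ≠ 0 := fun h0 => by
    have := hf q hq
    simp [hy, h0] at this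
  let w₀ := (InnerProductSpace.toDual ℝ (Euc d)).symm f
  have hw₀ : ∀ a, inner ℝ w₀ a = f a := fun a => InnerProductSpace.toDual_symm_apply
  have hne : w₀ ≠ 0 := fun h0 => hfe (by rw [← hw₀, h0, inner_zero_left])
  have hnorm : 0 < ‖w₀‖ := norm_pos_iff.2 hne
  let w := ‖w₀‖⁻¹ • w₀
  have hw : ∀ a, inner ℝ w a = ‖w₀‖⁻¹ * f a := fun a => by
    rw [real_inner_smul_left, hw₀]
  have hw1 : ‖w‖ = 1 := by
    rw [norm_smul, norm_inv, norm_norm, inv_mul_cancel₀ hnorm.ne']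
  refine ⟨w, ⟨hw1, ?_⟩, ?_⟩
  · rw [direction_affineSpan]
    have hw0 : w ≠ 0 := fun h => by simp [h] at hw1
    have hupper := Submodule.finrank_mono (vectorSpan_exposedFaceAt_le P w)
    have hsum := Submodule.finrank_add_finrank_orthogonal (ℝ ∙ w)
    rw [finrank_span_singleton hw0, finrank_euclideanSpace_fin] at hsum
    let T : Set (Euc d) := {s | s ∈ S ∧ f s = f y}
    have hyT : y ∈ affineSpan ℝ T := convexHull_subset_affineSpan T
      (mem_convexHull_filter_of_maximal S f.toLinearMap htP
        fun s hs => hfP s (subset_convexHull ℝ _ hs))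
    have hT : d ≤ Module.finrank ℝ (vectorSpan ℝ T) + 1 := by
      by_contra! h
      exact hgen T (fun s hs => hs.1) h t hyT
    have hTF : T ⊆ exposedFaceAt P w := fun s hs =>
      ⟨subset_convexHull ℝ _ hs.1, fun a ha => by
        rw [real_inner_comm, real_inner_comm w s, hw, hw, hs.2]
        exact mul_le_mul_of_nonneg_left (hfP a ha) (by positivity)⟩
    have hlower := Submodule.finrank_mono (vectorSpan_mono ℝ hTF)
    omega
  · rw [hw]
    exact mul_ne_zero (inv_ne_zero hnorm.ne') hfe

/-- The direction of a facet is the full orthogonal complement of its normal vector. -/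
lemma IsFacetNormal.vectorSpan_eq {P : Set (Euc d)} {w : Euc d} (hw : IsFacetNormal P w) :
    vectorSpan ℝ (exposedFaceAt P w) = (ℝ ∙ w)ᗮ := by
  have hw0 : w ≠ 0 := fun h => by simpa [h] using hw.1
  refine Submodule.eq_of_le_of_finrank_eq (vectorSpan_exposedFaceAt_le P w) ?_
  have hsum := Submodule.finrank_add_finrank_orthogonal (ℝ ∙ w)
  rw [finrank_span_singleton hw0, finrank_euclideanSpace_fin] at hsum
  rw [← direction_affineSpan, hw.2]
  omega

/-- every edge of the convex hull of a weakly (d-2)-impassable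
family of positive homothets of a d-polytope is covered by the family. -/
theorem stmt_16 (d n : ℕ) (hd : 3 ≤ d) (hn : 2 ≤ n)
    (P : Set (Euc d)) (hP : IsPolytope P)
    (x : Fin n → Euc d) (τ : Fin n → ℝ) (hτ : ∀ i, 0 < τ i)
    (hWIP : WIP (d - 2) P x τ) :
    ∀ u : Euc d, ‖u‖ = 1 →
      Module.finrank ℝ (affineSpan ℝ
        (exposedFaceAt (convexHull ℝ (⋃ i, homo (x i) (τ i) P)) u)).direction = 1 →
      exposedFaceAt (convexHull ℝ (⋃ i, homo (x i) (τ i) P)) u ⊆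
        ⋃ i, homo (x i) (τ i) P := by
  intro u hu hdim p hp
  set Q := convexHull ℝ (⋃ i, homo (x i) (τ i) P)
  rw [direction_affineSpan] at hdim
  obtain ⟨⟨e, heF⟩, he0, hespan⟩ := finrank_eq_one_iff'.1 hdim
  have he : e ≠ 0 := fun h => he0 (Subtype.ext h)
  have hue : inner ℝ u e = 0 := (Submodule.mem_orthogonal_singleton_iff_inner_right).1
    (vectorSpan_exposedFaceAt_le Q u heF)
  obtain ⟨w, hw, hwe⟩ := exists_isFacetNormal_inner_ne_zero hP he
  have hu0 : u ≠ 0 := fun h => by simp [h] at hu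
  have hlin : LinearIndependent ℝ ![u, w] := by
    refine LinearIndependent.pair_iff.2 fun a b hab => ?_
    have h1 := congrArg (fun z => inner ℝ z e) hab
    simp only [inner_add_left, real_inner_smul_left, hue, inner_zero_left, mul_zero,
      zero_add] at h1
    have hb : b = 0 := (mul_eq_zero.1 h1).resolve_right hwe
    simp only [hb, zero_smul, add_zero] at hab
    exact ⟨(smul_eq_zero.1 hab).resolve_right hu0, hb⟩
  let V := Submodule.span ℝ (Set.range ![u, w])
  have hV : Module.finrank ℝ V = 2 := by
    simpa using finrank_span_eq_card hlin
  have hVperp : Module.finrank ℝ Vᗮ = d - 2 := by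
    have hsum := Submodule.finrank_add_finrank_orthogonal V
    rw [hV, finrank_euclideanSpace_fin] at hsum
    omega
  have huV : u ∈ V := Submodule.subset_span ⟨0, rfl⟩
  have hwV : w ∈ V := Submodule.subset_span ⟨1, rfl⟩
  let A := AffineSubspace.mk' p Vᗮ
  obtain ⟨f₀, hf₀⟩ : (exposedFaceAt P w).Nonempty := by
    rw [Set.nonempty_iff_ne_empty]
    intro h
    have h1 := hw.2
    rw [direction_affineSpan, h, vectorSpan_empty, finrank_bot] at h1
    omega
  have hpA : p ∈ A := AffineSubspace.self_mem_mk' p _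
  have hpar : SubParallelToFacet P (A : Set (Euc d)) := by
    refine ⟨w, hw, f₀ - p, ?_⟩
    rintro _ ⟨z, hz, rfl⟩
    have hz' : z -ᵥ p ∈ Vᗮ := AffineSubspace.mem_mk'.1 hz
    have hdir : z - p ∈ vectorSpan ℝ (exposedFaceAt P w) := by
      rw [hw.vectorSpan_eq, Submodule.mem_orthogonal_singleton_iff_inner_right]
      exact hz' w hwV
    have h2 := AffineSubspace.vadd_mem_of_mem_direction
      ((direction_affineSpan ℝ (exposedFaceAt P w)).symm ▸ hdir) (mem_affineSpan ℝ hf₀)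
    have h3 : f₀ - p + z = (z - p) +ᵥ f₀ := by
      rw [vadd_eq_add]
      abel
    rw [← h3] at h2
    exact h2
  obtain ⟨i, z, hzA, hzi⟩ := hWIP A
    ⟨A, rfl, ⟨p, hpA⟩, by rw [AffineSubspace.direction_mk', hVperp]⟩ hpar ⟨p, hpA, hp.1⟩
  have hz' : z -ᵥ p ∈ Vᗮ := AffineSubspace.mem_mk'.1 hzA
  have hzu : inner ℝ z u = inner ℝ p u := by
    have h1 : inner ℝ u (z - p) = 0 := hz' u huV
    rw [real_inner_comm, inner_sub_left] at h1
    linarith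
  have hzF : z ∈ exposedFaceAt Q u :=
    ⟨subset_convexHull ℝ _ (Set.mem_iUnion.2 ⟨i, hzi⟩), fun a ha => hzu ▸ hp.2 a ha⟩
  obtain ⟨c, hc⟩ := hespan ⟨z -ᵥ p, vsub_mem_vectorSpan ℝ hzF hp⟩
  have hc' : c • e = z - p := congrArg Subtype.val hc
  have hwz : inner ℝ w (z - p) = 0 := hz' w hwV
  rw [← hc', real_inner_smul_right] at hwz
  have hc0 : c = 0 := (mul_eq_zero.1 hwz).resolve_right hwe
  have hzp : z = p := sub_eq_zero.1 (by rw [← hc', hc0, zero_smul])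
  exact Set.mem_iUnion.2 ⟨i, hzp ▸ hzi⟩

end
end

section
/- Let d ≥ 2. Then there exists an o-symmetric d-polytope P ⊂ ℝ^d such that for every ε > 0, every hyperplane of ℝ^d that is parallel to some facet of P intersects the lattice arrangement ℤ^d + εP = ⋃_{z∈ℤ^d}(z + εP). Equivalently, the first weak covering minimum satisfies μ₁^w(P, ℤ^d) = 0. -/
open Set Metric Pointwise MeasureTheory

noncomputable section

variable {d : ℕ}

/-- The direction space of a facet is the orthogonal complement of its normal vector. -/
theorem IsFacetNormal.direction_eq {P : Set (Euc d)} {u : Euc d} (hu : IsFacetNormal P u) :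
    (affineSpan ℝ (exposedFaceAt P u)).direction = (ℝ ∙ u)ᗮ := by
  have hu0 : u ≠ 0 := by
    rintro rfl
    simpa using hu.1
  refine Submodule.eq_of_le_of_finrank_eq ?_ ?_
  · rw [direction_affineSpan, vectorSpan_def, Submodule.span_le]
    rintro _ ⟨x, hx, y, hy, rfl⟩
    have h : inner ℝ x u = inner ℝ y u := le_antisymm (hy.2 x hx.1) (hx.2 y hy.1)
    simp [Submodule.mem_orthogonal_singleton_iff_inner_left, inner_sub_left, h]
  · have h := Submodule.finrank_add_finrank_orthogonal (ℝ ∙ u)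
    rw [finrank_span_singleton hu0, finrank_euclideanSpace_fin] at h
    rw [hu.2]
    omega

/-- A hyperplane parallel to the facet with normal `u` contains a level set of `⟪·, u⟫`. -/
theorem IsFacetNormal.exists_level_subset_of_hyperplane {P H : Set (Euc d)} {u : Euc d}
    (hu : IsFacetNormal P u) (hH : IsHyperplane H) {v : Euc d}
    (hv : exposedFaceAt P u ⊆ (fun x => v + x) '' H) :
    ∃ c : ℝ, {x : Euc d | inner ℝ x u = c} ⊆ H := by
  obtain ⟨w, hw0, c, rfl⟩ := hH
  have hle : (ℝ ∙ u)ᗮ ≤ (ℝ ∙ w)ᗮ := by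
    rw [← hu.direction_eq, direction_affineSpan, vectorSpan_def, Submodule.span_le]
    rintro _ ⟨x, hx, y, hy, rfl⟩
    obtain ⟨x, hxc, rfl⟩ := hv hx
    obtain ⟨y, hyc, rfl⟩ := hv hy
    simp only [mem_ofPred_eq] at hxc hyc
    simp [Submodule.mem_orthogonal_singleton_iff_inner_left, inner_sub_left, hxc, hyc]
  have hwu : w ∈ ℝ ∙ u := by
    rw [Submodule.orthogonal_le_orthogonal_iff] at hle
    exact hle (Submodule.mem_span_singleton_self w)
  obtain ⟨r, rfl⟩ := Submodule.mem_span_singleton.mp hwu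
  have hr : r ≠ 0 := by
    rintro rfl
    simp at hw0
  refine ⟨c / r, fun x hx => ?_⟩
  simp only [mem_ofPred_eq] at hx
  simp only [mem_ofPred_eq, inner_smul_right, hx]
  field_simp

/-- A `(d - 1)`-dimensional affine subspace parallel to the facet with normal `u` contains a level
set of `⟪·, u⟫`. -/
theorem IsFacetNormal.exists_level_subset_of_affSub {P A : Set (Euc d)} {u : Euc d}
    (hu : IsFacetNormal P u) (hA : IsAffSub (d - 1) A) {v : Euc d}
    (hv : (fun x => v + x) '' A ⊆ (affineSpan ℝ (exposedFaceAt P u) : Set (Euc d))) :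
    ∃ c : ℝ, {x : Euc d | inner ℝ x u = c} ⊆ A := by
  obtain ⟨S, rfl, ⟨p, hp⟩, hS⟩ := hA
  have hdir : S.direction = (ℝ ∙ u)ᗮ := by
    rw [← hu.direction_eq]
    refine Submodule.eq_of_le_of_finrank_eq ?_ (hS.trans hu.2.symm)
    rw [AffineSubspace.direction_eq_vectorSpan, vectorSpan_def, Submodule.span_le]
    rintro _ ⟨x, hx, y, hy, rfl⟩
    simpa using AffineSubspace.vsub_mem_direction (hv ⟨x, hx, rfl⟩) (hv ⟨y, hy, rfl⟩)
  refine ⟨inner ℝ p u, fun x hx => ?_⟩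
  simp only [mem_ofPred_eq] at hx
  have hxp : x -ᵥ p ∈ S.direction := by
    rw [hdir]
    simp [Submodule.mem_orthogonal_singleton_iff_inner_left, inner_sub_left, hx]
  exact (AffineSubspace.vsub_right_mem_direction_iff_mem hp x).mp hxp

/-- The vertices of the cross-polytope with semi-axes `a`. -/
def crossVertices (a : Fin d → ℝ) : Set (Euc d) :=
  (range fun i => EuclideanSpace.single i (a i)) ∪ range fun i => EuclideanSpace.single i (-a i)

/-- The cross-polytope with semi-axes `a`. -/
def crossPolytope (a : Fin d → ℝ) : Set (Euc d) := convexHull ℝ (crossVertices a)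

theorem neg_crossVertices (a : Fin d → ℝ) : -crossVertices a = crossVertices a := by
  have hneg (f : Fin d → Euc d) : -range f = range fun i => -f i := by
    rw [← image_neg_eq_neg, ← range_comp]; rfl
  rw [crossVertices, union_neg, hneg, hneg, union_comm]
  simp [← PiLp.single_neg]

theorem neg_crossPolytope (a : Fin d → ℝ) : -crossPolytope a = crossPolytope a := by
  rw [crossPolytope, ← convexHull_neg, neg_crossVertices]

theorem single_mem_crossPolytope (a : Fin d → ℝ) (i : Fin d) :
    EuclideanSpace.single i (a i) ∈ crossPolytope a :=
  subset_convexHull ℝ _ (Or.inl ⟨i, rfl⟩)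

theorem single_neg_mem_crossPolytope (a : Fin d → ℝ) (i : Fin d) :
    EuclideanSpace.single i (-a i) ∈ crossPolytope a :=
  subset_convexHull ℝ _ (Or.inr ⟨i, rfl⟩)

theorem single_mul_mem_crossPolytope (a : Fin d → ℝ) (i : Fin d) {s : ℝ} (hs : |s| ≤ 1) :
    EuclideanSpace.single i (s * a i) ∈ crossPolytope a := by
  obtain ⟨h₁, h₂⟩ := abs_le.mp hs
  have h : _ ∈ crossPolytope a := convex_convexHull ℝ (crossVertices a) (single_mem_crossPolytope a i)
    (single_neg_mem_crossPolytope a i) (a := (1 + s) / 2) (b := (1 - s) / 2)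
    (by linarith) (by linarith) (by ring)
  convert h using 1
  ext k
  by_cases hk : k = i
  · subst hk
    simp
    ring
  · simp [hk]

theorem isPolytope_crossPolytope [Nonempty (Fin d)] {a : Fin d → ℝ} (ha : ∀ i, 0 < a i) :
    IsPolytope (crossPolytope a) := by
  have hfin : (crossVertices a).Finite := (finite_range _).union (finite_range _)
  refine ⟨hfin.toFinset, by rw [hfin.coe_toFinset]; rfl, ?_⟩
  rw [crossPolytope, interior_convexHull_nonempty_iff_affineSpan_eq_top,
    AffineSubspace.affineSpan_eq_top_iff_vectorSpan_eq_top_of_nonempty ℝ _ _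
      (show (crossVertices a).Nonempty from (range_nonempty _).inl), eq_top_iff,
    ← (EuclideanSpace.basisFun (Fin d) ℝ).toBasis.span_eq, Submodule.span_le]
  rintro _ ⟨i, rfl⟩
  rw [SetLike.mem_coe]
  have h := (vectorSpan ℝ (crossVertices a)).smul_mem (2 * a i)⁻¹
    (vsub_mem_vectorSpan ℝ (Or.inl ⟨i, rfl⟩ : EuclideanSpace.single i (a i) ∈ crossVertices a)
      (Or.inr ⟨i, rfl⟩ : EuclideanSpace.single i (-a i) ∈ crossVertices a))
  convert h using 1
  ext k
  have := (ha i).ne'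
  by_cases hk : k = i
  · subst hk
    simp
    field_simp
    norm_num
  · simp [hk]

/-- The facet normals of a cross-polytope have coordinates of absolute values inversely
proportional to the semi-axes. -/
theorem IsFacetNormal.mul_abs_le_of_crossPolytope {a : Fin d → ℝ} (ha : ∀ i, 0 < a i) {u : Euc d}
    (hu : IsFacetNormal (crossPolytope a) u) (j k : Fin d) : a k * |u k| ≤ a j * |u j| := by
  by_contra! hlt
  have hface : ∀ x ∈ exposedFaceAt (crossPolytope a) u, x j = 0 := by
    rintro x ⟨hxP, hx⟩
    have hvert (i : Fin d) : a i * |u i| ≤ inner ℝ x u := by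
      rcases abs_cases (u i) with ⟨h, -⟩ | ⟨h, -⟩ <;> rw [h]
      · simpa [EuclideanSpace.inner_single_left] using hx _ (single_mem_crossPolytope a i)
      · simpa [EuclideanSpace.inner_single_left] using hx _ (single_neg_mem_crossPolytope a i)
    set M : ℝ := inner ℝ x u
    set δ : ℝ := (M - a j * |u j|) / a j
    have hδ0 : 0 < δ := div_pos (by linarith [hvert k]) (ha j)
    have hδa : δ * a j = M - a j * |u j| := div_mul_cancel₀ _ (ha j).ne'
    have hconv : ConvexOn ℝ univ fun y : Euc d => inner ℝ y u + δ * |y j| := by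
      refine ⟨convex_univ, fun y _ z _ s t hs ht _ => ?_⟩
      have h : |s * y j + t * z j| ≤ s * |y j| + t * |z j| := by
        refine (abs_add_le _ _).trans_eq ?_
        rw [abs_mul, abs_mul, abs_of_nonneg hs, abs_of_nonneg ht]
      have h' := mul_le_mul_of_nonneg_left h hδ0.le
      simp only [inner_add_left, inner_smul_left, PiLp.add_apply, PiLp.smul_apply, smul_eq_mul,
        conj_trivial]
      linarith
    have hbound (i : Fin d) (b : ℝ) (hb : |b| = a i) :
        inner ℝ (EuclideanSpace.single i b) u + δ * |EuclideanSpace.single i b j| ≤ M := by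
      have hbu : b * u i ≤ a i * |u i| := by
        rw [← hb, ← abs_mul]
        exact le_abs_self _
      by_cases hij : j = i
      · subst hij
        simp [EuclideanSpace.inner_single_left, hb]
        linarith
      · simp [EuclideanSpace.inner_single_left, hij]
        linarith [hvert i]
    have hsub : crossPolytope a ⊆ {y ∈ univ | inner ℝ y u + δ * |y j| ≤ M} := by
      refine convexHull_min ?_ (hconv.convex_le M)
      rintro _ (⟨i, rfl⟩ | ⟨i, rfl⟩)
      · exact ⟨trivial, hbound i _ (abs_of_pos (ha i))⟩
      · exact ⟨trivial, hbound i _ (by rw [abs_neg, abs_of_pos (ha i)])⟩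
    have hxj : M + δ * |x j| ≤ M := (hsub hxP).2
    have : |x j| ≤ 0 := by
      by_contra! h
      linarith [mul_pos hδ0 h]
    exact abs_nonpos_iff.mp this
  have hjk : j ≠ k := by
    rintro rfl
    exact lt_irrefl _ hlt
  have huk : u k ≠ 0 := by
    intro h
    rw [h, abs_zero, mul_zero] at hlt
    exact absurd hlt (not_lt.mpr (mul_nonneg (ha j).le (abs_nonneg _)))
  have hmem : EuclideanSpace.single j (u k) - EuclideanSpace.single k (u j) ∈ (ℝ ∙ u)ᗮ := by
    simp [Submodule.mem_orthogonal_singleton_iff_inner_left, inner_sub_left,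
      EuclideanSpace.inner_single_left, mul_comm]
  have hle : (ℝ ∙ u)ᗮ ≤ LinearMap.ker (EuclideanSpace.proj j : Euc d →L[ℝ] ℝ).toLinearMap := by
    rw [← hu.direction_eq, direction_affineSpan, vectorSpan_def, Submodule.span_le]
    rintro _ ⟨x, hx, y, hy, rfl⟩
    simp [hface x hx, hface y hy]
  have h := hle hmem
  simp [hjk] at h
  exact huk h

/-- If two coordinates of `u` have irrational ratio, small homothets of a cross-polytope centred at
the integer points meet every level set of `⟪·, u⟫`. -/
theorem exists_mem_intLattice_add_smul_crossPolytope {a : Fin d → ℝ} (ha : ∀ i, 0 < a i)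
    {u : Euc d} {i j : Fin d} (hij : Irrational (u i / u j)) {ε : ℝ} (hε : 0 < ε) (c : ℝ) :
    ∃ x ∈ intLattice d + ε • crossPolytope a, inner ℝ x u = c := by
  have huj : u j ≠ 0 := by
    intro h
    simp [h] at hij
  have hη : 0 < ε * a j * |u j| := mul_pos (mul_pos hε (ha j)) (abs_pos.mpr huj)
  obtain ⟨y, hy, hyc⟩ :=
    (dense_addSubgroupClosure_pair_iff.mpr hij).exists_dist_lt c hη
  obtain ⟨m, n, rfl⟩ := AddSubgroup.mem_closure_pair.mp hy
  rw [Real.dist_eq] at hyc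
  set b : ℝ := m • u i + n • u j with hb
  set s : ℝ := (c - b) / (ε * a j * u j) with hs
  have hs1 : |s| ≤ 1 := by
    rw [hs, abs_div, abs_mul, abs_of_pos (mul_pos hε (ha j))]
    exact (div_le_one hη).mpr hyc.le
  refine ⟨_, add_mem_add (a := EuclideanSpace.single i (m : ℝ) + EuclideanSpace.single j (n : ℝ)) ?_
    (smul_mem_smul_set (single_mul_mem_crossPolytope a j hs1)), ?_⟩
  · intro k
    refine ⟨(if k = i then m else 0) + if k = j then n else 0, ?_⟩
    simp
  · have haj := (ha j).ne'
    have hsc : ε * (s * a j * u j) = c - b := by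
      rw [hs]
      field_simp
    simp [inner_add_left, inner_smul_left, EuclideanSpace.inner_single_left, hsc]
    simp [hb]


/-- there is an o-symmetric d-polytope `P` with vanishing first
weak covering minimum with respect to `ℤ^d`. -/
theorem stmt_17 (d : ℕ) (hd : 2 ≤ d) :
    ∃ P : Set (Euc d), IsPolytope P ∧ P = -P ∧
      (∀ ε : ℝ, 0 < ε → ∀ H : Set (Euc d), IsHyperplane H → HypParallelToFacet P H →
        (H ∩ (intLattice d + ε • P)).Nonempty) ∧
      sInf {t : ℝ | 0 < t ∧ ∀ A : Set (Euc d), IsAffSub (d - 1) A →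
        SubParallelToFacet P A → (A ∩ (intLattice d + t • P)).Nonempty} = 0 := by
  let i : Fin d := ⟨0, by omega⟩
  let j : Fin d := ⟨1, by omega⟩
  have hij : j ≠ i := by simp [i, j]
  have : Nonempty (Fin d) := ⟨i⟩
  let a : Fin d → ℝ := fun k => if k = i then √2 else 1
  have ha (k : Fin d) : 0 < a k := by
    simp only [a]
    split_ifs <;> positivity
  have hirr {u : Euc d} (hu : IsFacetNormal (crossPolytope a) u) : Irrational (u j / u i) := by
    have heq (k l : Fin d) : a k * |u k| = a l * |u l| :=
      le_antisymm (hu.mul_abs_le_of_crossPolytope ha l k) (hu.mul_abs_le_of_crossPolytope ha k l)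
    have hui : u i ≠ 0 := by
      intro h
      have hu0 : u = 0 := by
        ext k
        have hk := heq k i
        rw [h, abs_zero, mul_zero] at hk
        simpa [(ha k).ne'] using hk
      simpa [hu0] using hu.1
    have hratio : |u j / u i| = √2 := by
      have h := heq j i
      simp only [a, if_neg hij, if_true, one_mul] at h
      rw [abs_div, h, mul_div_assoc, div_self (abs_ne_zero.mpr hui), mul_one]
    rcases (abs_eq (by positivity)).mp hratio with h | h <;> rw [h]
    · exact irrational_sqrt_two
    · exact irrational_sqrt_two.neg
  refine ⟨crossPolytope a, isPolytope_crossPolytope ha, (neg_crossPolytope a).symm, ?_, ?_⟩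
  · rintro ε hε H hH ⟨u, hu, v, hv⟩
    obtain ⟨c, hc⟩ := hu.exists_level_subset_of_hyperplane hH hv
    obtain ⟨x, hx, hxc⟩ := exists_mem_intLattice_add_smul_crossPolytope ha (hirr hu) hε c
    exact ⟨x, hc hxc, hx⟩
  · refine Eq.trans (congrArg sInf ?_) (csInf_Ioi (a := (0 : ℝ)))
    ext t
    refine ⟨fun ht => ht.1, fun ht => ⟨ht, ?_⟩⟩
    rintro A hA ⟨u, hu, v, hv⟩
    obtain ⟨c, hc⟩ := hu.exists_level_subset_of_affSub hA hv
    obtain ⟨x, hx, hxc⟩ := exists_mem_intLattice_add_smul_crossPolytope ha (hirr hu) ht c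
    exact ⟨x, hc hxc, hx⟩

end
end

section
/- Let v = (θ₁, θ₂, …, θ_d) ∈ ℝ^d be a vector whose coordinates θ₁, …, θ_d are linearly independent over the field ℚ of rational numbers, and let L = ℝv ⊂ ℝ^d be the line through the origin spanned by v. Then the set ℤ^d + L = {z + t·v : z ∈ ℤ^d, t ∈ ℝ} is dense in ℝ^d. -/
open Set Metric Pointwise MeasureTheory

noncomputable section

variable {d : ℕ}

/-- Integration of a continuous function over a translate of a closed subgroup of the torus,
with respect to the Haar probability measure of the subgroup. -/
def cosetIntegral {ι : Type*} [Fintype ι] (H : AddSubgroup (UnitAddTorus ι)) [CompactSpace H]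
    (x : UnitAddTorus ι) : C(UnitAddTorus ι, ℂ) →L[ℂ] ℂ :=
  LinearMap.mkContinuous
    { toFun := fun f => ∫ h : H, f (x + h) ∂Measure.addHaarMeasure ⊤
      map_add' := fun f g => integral_add
        (Continuous.integrable_of_hasCompactSupport (by fun_prop) (.of_compactSpace _))
        (Continuous.integrable_of_hasCompactSupport (by fun_prop) (.of_compactSpace _))
      map_smul' := fun c f => integral_const_mul c _ }
    ((Measure.addHaarMeasure (⊤ : TopologicalSpace.PositiveCompacts H)).real univ)
    fun f => by
      rw [mul_comm]
      exact norm_integral_le_of_norm_le_const (.of_forall fun h => f.norm_coe_le_norm _)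

theorem cosetIntegral_apply {ι : Type*} [Fintype ι] (H : AddSubgroup (UnitAddTorus ι))
    [CompactSpace H] (x : UnitAddTorus ι) (f : C(UnitAddTorus ι, ℂ)) :
    cosetIntegral H x f = ∫ h : H, f (x + h) ∂Measure.addHaarMeasure ⊤ :=
  rfl

theorem UnitAddTorus.mFourier_apply_add {ι : Type*} [Fintype ι] (n : ι → ℤ)
    (x y : UnitAddTorus ι) :
    mFourier n (x + y) = mFourier n x * mFourier n y := by
  simp [mFourier, fourier_apply, smul_add, AddCircle.toCircle_add, Finset.prod_mul_distrib]

theorem cosetIntegral_mFourier_eq_zero {ι : Type*} [Fintype ι]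
    (H : AddSubgroup (UnitAddTorus ι)) [CompactSpace H] (x : UnitAddTorus ι) {n : ι → ℤ}
    (hn : ∃ h ∈ H, UnitAddTorus.mFourier n h ≠ 1) :
    cosetIntegral H x (UnitAddTorus.mFourier n) = 0 := by
  obtain ⟨g, hg, hne⟩ := hn
  have key := integral_add_right_eq_self (μ := Measure.addHaarMeasure ⊤)
    (fun h : H => UnitAddTorus.mFourier n (x + h)) ⟨g, hg⟩
  simp only [AddSubgroup.coe_add, ← add_assoc] at key
  simp only [UnitAddTorus.mFourier_apply_add _ (_ + _) g, integral_mul_const] at key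
  rw [← cosetIntegral_apply] at key
  exact (mul_right_eq_self₀.mp key).resolve_left hne

/-- A closed subgroup of the torus on which no nonzero character is trivial is the whole torus. -/
theorem UnitAddTorus.eq_top_of_forall_mFourier_ne_one {ι : Type*} [Fintype ι]
    {H : AddSubgroup (UnitAddTorus ι)} (hH : IsClosed (H : Set (UnitAddTorus ι)))
    (hchar : ∀ n : ι → ℤ, n ≠ 0 → ∃ h ∈ H, mFourier n h ≠ 1) : H = ⊤ := by
  have : CompactSpace H := isCompact_iff_compactSpace.mp hH.isCompact
  rw [AddSubgroup.eq_top_iff']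
  intro x
  by_contra hx
  have hΛ : cosetIntegral H x = cosetIntegral H 0 := by
    refine ContinuousLinearMap.ext_on
      (Submodule.dense_iff_topologicalClosure_eq_top.mpr span_mFourier_closure_eq_top) ?_
    rintro _ ⟨n, rfl⟩
    rcases eq_or_ne n 0 with rfl | hn
    · simp [cosetIntegral_apply, mFourier_zero]
    · simp only [cosetIntegral_mFourier_eq_zero H _ (hchar n hn)]
  obtain ⟨f, hf0, hf1, hf⟩ := exists_continuous_zero_one_of_isClosed hH
    (isClosed_singleton (x := x)) (by simpa using hx)
  have hpos : 0 < ∫ h : H, f (x + h) ∂Measure.addHaarMeasure ⊤ :=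
    Continuous.integral_pos_of_hasCompactSupport_nonneg_nonzero (x := 0) (by fun_prop)
      (.of_compactSpace _) (fun h => (hf _).1) (by simp [hf1 rfl])
  have hzero : ∀ h : H, f h = 0 := fun h => hf0 h.2
  have hint := DFunLike.congr_fun hΛ
    ((⟨Complex.ofReal, Complex.continuous_ofReal⟩ : C(ℝ, ℂ)).comp f)
  simp only [cosetIntegral_apply, ContinuousMap.comp_apply, ContinuousMap.coe_mk, zero_add, hzero,
    Complex.ofReal_zero, integral_zero, integral_complex_ofReal, Complex.ofReal_eq_zero] at hint
  exact hpos.ne' hint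

/-- The quotient map from `ℝ^d` onto the torus. -/
def toTorus (d : ℕ) : Euc d →+ UnitAddTorus (Fin d) where
  toFun x i := (x i : UnitAddCircle)
  map_zero' := by ext; simp
  map_add' x y := by ext; simp

theorem isOpenMap_toTorus (d : ℕ) : IsOpenMap (toTorus d) :=
  (IsOpenMap.piMap (fun _ => QuotientAddGroup.isOpenMap_coe) (by simp)).comp
    (EuclideanSpace.equiv (Fin d) ℝ).toHomeomorph.isOpenMap

theorem mFourier_toTorus_smul (n : Fin d → ℤ) (v : Euc d) (t : ℝ) :
    UnitAddTorus.mFourier n (toTorus d (t • v)) =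
      Complex.exp (2 * Real.pi * Complex.I * (t * ∑ i, n i * v i : ℝ)) := by
  simp only [UnitAddTorus.mFourier, toTorus, ContinuousMap.coe_mk, AddMonoidHom.coe_mk,
    ZeroHom.coe_mk, fourier_coe_apply, ← Complex.exp_sum]
  congr 1
  push_cast
  rw [Finset.mul_sum, Finset.mul_sum]
  refine Finset.sum_congr rfl fun i _ => ?_
  simp
  ring

/-- The line spanned by a vector with rationally independent coordinates has dense image in the
torus. -/
theorem dense_toTorus_line {v : Euc d} (hv : LinearIndependent ℚ (fun i : Fin d => v i)) :
    Dense (range fun t : ℝ => toTorus d (t • v)) := by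
  let φ : ℝ →+ UnitAddTorus (Fin d) := (toTorus d).comp (LinearMap.toSpanSingleton ℝ _ v)
  have htop : φ.range.topologicalClosure = ⊤ := by
    refine UnitAddTorus.eq_top_of_forall_mFourier_ne_one
      (AddSubgroup.isClosed_topologicalClosure _) fun n hn => ?_
    have hs : ∑ i, n i * v i ≠ 0 := fun h0 => hn <| funext fun i => by
      have := Fintype.linearIndependent_iff.mp hv (fun i => (n i : ℚ))
        (by simpa [Rat.smul_def] using h0) i
      exact_mod_cast this
    refine ⟨toTorus d ((2 * ∑ i, n i * v i)⁻¹ • v),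
      AddSubgroup.le_topologicalClosure _ ⟨_, rfl⟩, ?_⟩
    have harg : 2 * Real.pi * Complex.I * ((2 * ∑ i, n i * v i)⁻¹ * ∑ i, n i * v i : ℝ) =
        Real.pi * Complex.I := by
      rw [mul_inv, mul_assoc 2⁻¹, inv_mul_cancel₀ hs]
      push_cast
      ring
    rw [mFourier_toTorus_smul, harg, Complex.exp_pi_mul_I]
    norm_num
  rw [dense_iff_closure_eq]
  exact congrArg SetLike.coe htop

theorem mem_intLattice_iff {x : Euc d} : x ∈ intLattice d ↔ toTorus d x = 0 := by
  simp only [intLattice, mem_ofPred_eq, toTorus, AddMonoidHom.coe_mk, ZeroHom.coe_mk,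
    funext_iff, Pi.zero_apply, AddCircle.coe_eq_zero_iff]
  simp [eq_comm]

/-- Kronecker-type density — if the coordinates of `v` are
linearly independent over `ℚ`, then `ℤ^d + ℝv` is dense in `ℝ^d`. -/
theorem stmt_18 (d : ℕ) (v : Euc d)
    (hv : LinearIndependent ℚ (fun i : Fin d => v i)) :
    Dense (intLattice d + Set.range fun t : ℝ => t • v) := by
  have hset : (intLattice d + range fun t : ℝ => t • v) =
      toTorus d ⁻¹' range fun t : ℝ => toTorus d (t • v) := by
    ext x
    constructor
    · rintro ⟨z, hz, _, ⟨t, rfl⟩, rfl⟩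
      exact ⟨t, by simp [mem_intLattice_iff.mp hz]⟩
    · rintro ⟨t, ht⟩
      refine ⟨x - t • v, mem_intLattice_iff.mpr ?_, t • v, ⟨t, rfl⟩, sub_add_cancel _ _⟩
      rw [map_sub, sub_eq_zero]
      exact ht.symm
  rw [hset]
  exact (dense_toTorus_line hv).preimage (isOpenMap_toTorus d)

end
end
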